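/- There exist ε₀ > 0 and C > 0 such that if f is a (1+ε)-biLipschitz self map of ℍ with 0 ≤ ε < ε₀ and f(O) = O, then for every R > 0 there exists A ∈ O(2) such that (1/ℒ(B(O,R))) ∫_{B(O,R)} ‖Jf(Q) − A‖ dQ ≤ C ε^{1/4096}, where Jf is the a.e.-defined Pansu Jacobian matrix of f. -/

import Mathlib

noncomputable section

open MeasureTheory

/-- Points of the Heisenberg group `ℍ`, identified with `ℝ³ ≅ ℂ × ℝ`:
`(x, y, t)` corresponds to `(z ; t)` with `z = x + iy`. -/
abbrev H : Type := ℝ × ℝ × ℝ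

/-- The Heisenberg group law
`(x,y,t)·(x',y',t') = (x+x', y+y', t+t'+2(x'y − xy'))`. -/
def Hmul (p q : H) : H :=
  (p.1 + q.1, p.2.1 + q.2.1, p.2.2 + q.2.2 + 2 * (q.1 * p.2.1 - p.1 * q.2.1))

/-- The Heisenberg group inverse. -/
def Hinv (p : H) : H := (-p.1, -p.2.1, -p.2.2)

/-- The identity `O = (0,0,0)`. -/
def HO : H := (0, 0, 0)

/-- The control (Carnot–Carathéodory) distance: the infimum of the lengths
`∫₀¹ √(a(s)² + b(s)²) ds` of horizontal Lipschitz curves `γ` joining `P` to `Q`,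
i.e. curves satisfying a.e. `γ' = a·X(γ) + b·Y(γ)` where `X = ∂ₓ + 2y∂_t` and
`Y = ∂_y − 2x∂_t`. -/
def dH (P Q : H) : ℝ :=
  sInf { L : ℝ | ∃ (γ : ℝ → H) (a b : ℝ → ℝ) (K : NNReal),
    LipschitzWith K γ ∧ γ 0 = P ∧ γ 1 = Q ∧
    (∀ᵐ s ∂volume, s ∈ Set.Icc (0:ℝ) 1 →
      HasDerivAt γ (a s, b s, 2 * (γ s).2.1 * a s - 2 * (γ s).1 * b s) s) ∧
    IntervalIntegrable (fun s => Real.sqrt (a s ^ 2 + b s ^ 2)) volume 0 1 ∧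
    L = ∫ s in (0:ℝ)..1, Real.sqrt (a s ^ 2 + b s ^ 2) }

/-- `γ : ℝ → ℍ` is a `(1+ε)`-quasigeodesic. -/
def IsQuasiGeodesic (ε : ℝ) (γ : ℝ → H) : Prop :=
  ∀ s s' : ℝ, (1 + ε)⁻¹ * |s - s'| ≤ dH (γ s) (γ s') ∧
    dH (γ s) (γ s') ≤ (1 + ε) * |s - s'|

/-- `f : ℍ → ℍ` is `(1+ε)`-biLipschitz for the control distance. -/
def IsBiLip (ε : ℝ) (f : H → H) : Prop :=
  ∀ P Q : H, (1 + ε)⁻¹ * dH P Q ≤ dH (f P) (f Q) ∧ dH (f P) (f Q) ≤ (1 + ε) * dH P Q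

/-- `(a,b)` is the horizontal speed of `γ`: a.e. `γ'(s) = a(s)X(γ(s)) + b(s)Y(γ(s))`. -/
def HasHorizSpeed (γ : ℝ → H) (a b : ℝ → ℝ) : Prop :=
  ∀ᵐ s ∂volume, HasDerivAt γ (a s, b s, 2 * (γ s).2.1 * a s - 2 * (γ s).1 * b s) s

/-- The Heisenberg dilation `δ_λ(z;t) = (λz; λ²t)`. -/
def Hdil (l : ℝ) (p : H) : H := (l * p.1, l * p.2.1, l ^ 2 * p.2.2)

/-- `f` is Pansu differentiable at `P` with Pansu Jacobian the `2×2` matrix `A`: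
`δ_{1/σ}(f(P)⁻¹ · f(P · δ_σ(u,v,w)))` converges, as `σ → 0⁺` and uniformly on
compact sets of `(u,v,w)`, to `(A(u,v); det(A)·w)`. -/
def HasPansuJacobianAt (f : H → H) (A : Matrix (Fin 2) (Fin 2) ℝ) (P : H) : Prop :=
  ∀ K : Set H, IsCompact K → ∀ δ : ℝ, 0 < δ → ∃ σ₀ > (0:ℝ), ∀ σ : ℝ, 0 < σ → σ < σ₀ →
    ∀ Q ∈ K,
      dist (Hdil σ⁻¹ (Hmul (Hinv (f P)) (f (Hmul P (Hdil σ Q)))))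
        ((A 0 0 * Q.1 + A 0 1 * Q.2.1, A 1 0 * Q.1 + A 1 1 * Q.2.1,
          A.det * Q.2.2) : H) < δ

/-- The operator norm of a `2×2` real matrix (acting on Euclidean `ℝ²`). -/
def matOpNorm (A : Matrix (Fin 2) (Fin 2) ℝ) : ℝ :=
  sSup { r : ℝ | ∃ x y : ℝ, x ^ 2 + y ^ 2 ≤ 1 ∧
    r = Real.sqrt ((A 0 0 * x + A 0 1 * y) ^ 2 + (A 1 0 * x + A 1 1 * y) ^ 2) }

/-- `L` is the length of a horizontal curve from `P` to `Q`. -/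
def Conn (P Q : H) (L : ℝ) : Prop :=
  ∃ (γ : ℝ → H) (a b : ℝ → ℝ) (K : NNReal),
    LipschitzWith K γ ∧ γ 0 = P ∧ γ 1 = Q ∧
    (∀ᵐ s ∂volume, s ∈ Set.Icc (0:ℝ) 1 →
      HasDerivAt γ (a s, b s, 2 * (γ s).2.1 * a s - 2 * (γ s).1 * b s) s) ∧
    IntervalIntegrable (fun s => Real.sqrt (a s ^ 2 + b s ^ 2)) volume 0 1 ∧
    L = ∫ s in (0:ℝ)..1, Real.sqrt (a s ^ 2 + b s ^ 2)

lemma dH_eq (P Q : H) : dH P Q = sInf {L : ℝ | Conn P Q L} := rfl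

lemma Conn.nonneg {P Q : H} {L : ℝ} (h : Conn P Q L) : 0 ≤ L := by
  obtain ⟨γ, a, b, K, h1, h2, h3, h4, h5, h6⟩ := h
  rw [h6]
  exact intervalIntegral.integral_nonneg zero_le_one (fun s _ => Real.sqrt_nonneg _)

lemma conn_bdd (P Q : H) : BddBelow {L : ℝ | Conn P Q L} := ⟨0, fun _ h => Conn.nonneg h⟩

lemma ae_affine {p : ℝ → Prop} (h : ∀ᵐ s ∂(volume : Measure ℝ), p s) (c : ℝ) :
    ∀ᵐ s ∂(volume : Measure ℝ), p (2 * s + c) := by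
  rw [ae_iff] at h ⊢
  have h1 : {s : ℝ | ¬ p (2 * s + c)} = (fun s => 2 * s) ⁻¹' ((fun s => s + c) ⁻¹' {s | ¬ p s}) := rfl
  rw [h1, Real.volume_preimage_mul_left (by norm_num : (2:ℝ) ≠ 0), measure_preimage_add_right, h,
    mul_zero]

lemma Conn.trans {P Q R : H} {L L' : ℝ} (h : Conn P Q L) (h' : Conn Q R L') :
    Conn P R (L + L') := by
  obtain ⟨γ, a, b, K, h1, h2, h3, h4, h5, h6⟩ := h
  obtain ⟨γ', a', b', K', h1', h2', h3', h4', h5', h6'⟩ := h'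
  have e1 : Set.EqOn
      (fun s => Real.sqrt ((if s ≤ 1/2 then 2 * a (2*s+0) else 2 * a' (2*s+(-1)))^2 +
        (if s ≤ 1/2 then 2 * b (2*s+0) else 2 * b' (2*s+(-1)))^2))
      (fun s => 2 * Real.sqrt (a (2*s+0)^2 + b (2*s+0)^2)) (Set.uIoc 0 (1/2)) := by
    intro s hs
    rw [Set.uIoc_of_le (by norm_num)] at hs
    simp only [hs.2, if_true]
    rw [show (2 * a (2*s+0))^2 + (2 * b (2*s+0))^2 = 2^2 * (a (2*s+0)^2 + b (2*s+0)^2) by ring,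
      Real.sqrt_mul (by positivity), Real.sqrt_sq (by norm_num)]
  have e2 : Set.EqOn
      (fun s => Real.sqrt ((if s ≤ 1/2 then 2 * a (2*s+0) else 2 * a' (2*s+(-1)))^2 +
        (if s ≤ 1/2 then 2 * b (2*s+0) else 2 * b' (2*s+(-1)))^2))
      (fun s => 2 * Real.sqrt (a' (2*s+(-1))^2 + b' (2*s+(-1))^2)) (Set.uIoc (1/2) 1) := by
    intro s hs
    rw [Set.uIoc_of_le (by norm_num)] at hs
    simp only [not_le.mpr hs.1, if_false]
    rw [show (2 * a' (2*s+(-1)))^2 + (2 * b' (2*s+(-1)))^2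
        = 2^2 * (a' (2*s+(-1))^2 + b' (2*s+(-1))^2) by ring,
      Real.sqrt_mul (by positivity), Real.sqrt_sq (by norm_num)]
  have i1 : IntervalIntegrable (fun s => 2 * Real.sqrt (a (2*s+0)^2 + b (2*s+0)^2)) volume 0 (1/2) := by
    have := (h5.comp_mul_left (c := 2)).const_mul 2
    simpa using this
  have i2 : IntervalIntegrable (fun s => 2 * Real.sqrt (a' (2*s+(-1))^2 + b' (2*s+(-1))^2))
      volume (1/2) 1 := by
    have := ((h5'.comp_add_right (-1)).comp_mul_left (c := 2)).const_mul 2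
    norm_num at this ⊢
    exact this
  have j1 := i1.congr e1.symm
  have j2 := i2.congr e2.symm
  refine ⟨fun s => if s ≤ 1/2 then γ (2*s+0) else γ' (2*s+(-1)),
    fun s => if s ≤ 1/2 then 2 * a (2*s+0) else 2 * a' (2*s+(-1)),
    fun s => if s ≤ 1/2 then 2 * b (2*s+0) else 2 * b' (2*s+(-1)), 2 * (K + K'), ?_, ?_, ?_, ?_, ?_, ?_⟩
  · have key : ∀ s s' : ℝ, s ≤ s' →
        dist ((fun s => if s ≤ 1/2 then γ (2*s+0) else γ' (2*s+(-1))) s)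
          ((fun s => if s ≤ 1/2 then γ (2*s+0) else γ' (2*s+(-1))) s')
          ≤ 2 * (K + K') * (s' - s) := by
      intro s s' hss
      have hK := K.2
      have hK' := K'.2
      have d1 : ∀ u v : ℝ, u ≤ v → dist (γ u) (γ v) ≤ K * (v - u) := by
        intro u v huv
        have := h1.dist_le_mul u v
        rwa [Real.dist_eq, abs_sub_comm, abs_of_nonneg (by linarith)] at this
      have d2 : ∀ u v : ℝ, u ≤ v → dist (γ' u) (γ' v) ≤ K' * (v - u) := by
        intro u v huv
        have := h1'.dist_le_mul u v
        rwa [Real.dist_eq, abs_sub_comm, abs_of_nonneg (by linarith)] at this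
      have m1 : 0 ≤ (K:ℝ) * (s' - s) := mul_nonneg hK (by linarith)
      have m2 : 0 ≤ (K':ℝ) * (s' - s) := mul_nonneg hK' (by linarith)
      by_cases c1 : s ≤ 1/2
      · by_cases c2 : s' ≤ 1/2
        · simp only [c1, c2, if_true]
          have := d1 (2*s+0) (2*s'+0) (by linarith)
          nlinarith
        · simp only [c1, c2, if_true, if_false]
          push Not at c2
          have t1 := d1 (2*s+0) 1 (by linarith)
          have t2 := d2 0 (2*s'+(-1)) (by linarith)
          have t3 := dist_triangle (γ (2*s+0)) (γ 1) (γ' (2*s'+(-1)))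
          rw [h2'] at t2
          rw [h3] at t3 t1
          have m3 : (K:ℝ) * (1 - 2 * s) ≤ K * (2*s' - 2 * s) := mul_le_mul_of_nonneg_left (by linarith) hK
          have m4 : (K':ℝ) * (2 * s' - 1) ≤ K' * (2*s' - 2 * s) := mul_le_mul_of_nonneg_left (by linarith) hK'
          nlinarith
      · have c2 : ¬ s' ≤ 1/2 := by
          push Not at c1 ⊢; linarith
        simp only [c1, c2, if_false]
        have := d2 (2*s+(-1)) (2*s'+(-1)) (by linarith)
        nlinarith
    refine LipschitzWith.of_dist_le_mul fun s s' => ?_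
    rw [Real.dist_eq]
    push_cast
    rcases le_total s s' with c | c
    · rw [abs_sub_comm, abs_of_nonneg (by linarith : 0 ≤ s' - s)]
      exact key s s' c
    · rw [dist_comm, abs_of_nonneg (by linarith : 0 ≤ s - s')]
      exact key s' s c
  · norm_num [h2]
  · norm_num [h3']
  · have hne : ∀ᵐ s ∂(volume : Measure ℝ), s ≠ 1/2 := by
      rw [ae_iff]; simp
    filter_upwards [ae_affine h4 0, ae_affine h4' (-1), hne] with s g1 g2 g3 hs
    rcases lt_or_gt_of_ne g3 with c | c
    · have e : (fun s => if s ≤ 1/2 then γ (2*s+0) else γ' (2*s+(-1))) =ᶠ[nhds s]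
          (fun s => γ (2*s+0)) := by
        filter_upwards [Iio_mem_nhds c] with u hu
        have hu' : u ≤ 1/2 := le_of_lt hu
        simp only [hu', if_true]
      have D := g1 ⟨by linarith [hs.1], by linarith⟩
      have D2 := HasDerivAt.scomp (h := fun s : ℝ => 2 * s + 0) (h' := 2) s D
        (by simpa using ((hasDerivAt_id s).const_mul (2:ℝ)))
      refine (D2.congr_of_eventuallyEq e).congr_deriv ?_
      simp only [c.le, if_true]
      ext <;> simp <;> ring
    · have e : (fun s => if s ≤ 1/2 then γ (2*s+0) else γ' (2*s+(-1))) =ᶠ[nhds s]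
          (fun s => γ' (2*s+(-1))) := by
        filter_upwards [Ioi_mem_nhds c] with u hu
        have hu' : ¬ u ≤ 1/2 := not_le.mpr hu
        simp only [hu', if_false]
      have D := g2 ⟨by linarith, by linarith [hs.2]⟩
      have D2 := HasDerivAt.scomp (h := fun s : ℝ => 2 * s + (-1)) (h' := 2) s D
        (by simpa using ((hasDerivAt_id s).const_mul (2:ℝ)).add_const (-1:ℝ))
      refine (D2.congr_of_eventuallyEq e).congr_deriv ?_
      simp only [not_le.mpr c, if_false]
      ext <;> simp <;> ring
  · exact j1.trans j2
  · rw [← intervalIntegral.integral_add_adjacent_intervals j1 j2,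
      intervalIntegral.integral_congr_ae (Filter.Eventually.of_forall e1),
      intervalIntegral.integral_congr_ae (Filter.Eventually.of_forall e2), h6, h6',
      intervalIntegral.integral_const_mul, intervalIntegral.integral_const_mul,
      intervalIntegral.integral_comp_mul_add (fun s => Real.sqrt (a s ^ 2 + b s ^2)) two_ne_zero,
      intervalIntegral.integral_comp_mul_add (fun s => Real.sqrt (a' s ^ 2 + b' s ^2)) two_ne_zero]
    norm_num
    ring

lemma hd1 {γ : ℝ → H} {v : H} {s : ℝ} (h : HasDerivAt γ v s) :
    HasDerivAt (fun u => (γ u).1) v.1 s :=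
  (ContinuousLinearMap.fst ℝ ℝ (ℝ × ℝ)).hasFDerivAt.comp_hasDerivAt s h

lemma hd2 {γ : ℝ → H} {v : H} {s : ℝ} (h : HasDerivAt γ v s) :
    HasDerivAt (fun u => (γ u).2.1) v.2.1 s :=
  ((ContinuousLinearMap.fst ℝ ℝ ℝ).comp
    (ContinuousLinearMap.snd ℝ ℝ (ℝ × ℝ))).hasFDerivAt.comp_hasDerivAt s h

lemma hd3 {γ : ℝ → H} {v : H} {s : ℝ} (h : HasDerivAt γ v s) :
    HasDerivAt (fun u => (γ u).2.2) v.2.2 s :=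
  ((ContinuousLinearMap.snd ℝ ℝ ℝ).comp
    (ContinuousLinearMap.snd ℝ ℝ (ℝ × ℝ))).hasFDerivAt.comp_hasDerivAt s h

lemma Conn.left {P Q : H} {L : ℝ} (h : Conn P Q L) (g : H) : Conn (Hmul g P) (Hmul g Q) L := by
  obtain ⟨γ, a, b, K, h1, h2, h3, h4, h5, h6⟩ := h
  have hl : ∃ C : NNReal, LipschitzWith C (fun p : H => Hmul g p) := by
    let l : H →L[ℝ] H := (ContinuousLinearMap.fst ℝ ℝ (ℝ × ℝ)).prod
      (((ContinuousLinearMap.fst ℝ ℝ ℝ).comp (ContinuousLinearMap.snd ℝ ℝ (ℝ × ℝ))).prod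
      (((ContinuousLinearMap.snd ℝ ℝ ℝ).comp (ContinuousLinearMap.snd ℝ ℝ (ℝ × ℝ))) +
       (2 * g.2.1) • (ContinuousLinearMap.fst ℝ ℝ (ℝ × ℝ)) -
       (2 * g.1) • ((ContinuousLinearMap.fst ℝ ℝ ℝ).comp (ContinuousLinearMap.snd ℝ ℝ (ℝ × ℝ)))))
    refine ⟨‖l‖₊, LipschitzWith.of_dist_le_mul fun p q => ?_⟩
    have := l.lipschitz.dist_le_mul p q
    refine le_trans (le_of_eq ?_) this
    rw [dist_eq_norm, dist_eq_norm]
    congr 1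
    ext <;> simp [Hmul, l] <;> ring
  obtain ⟨C, hC⟩ := hl
  refine ⟨fun s => Hmul g (γ s), a, b, C * K, hC.comp h1, by simp [h2], by simp [h3], ?_, h5, h6⟩
  filter_upwards [h4] with s hs hs'
  have D := hs hs'
  have D1 := hd1 D
  have D2 := hd2 D
  have D3 := hd3 D
  simp only [Hmul] at *
  have D4 := ((D3.const_add g.2.2).add (((D1.mul_const g.2.1).sub (D2.const_mul g.1)).const_mul 2))
  have := (D1.const_add g.1).prodMk ((D2.const_add g.2.1).prodMk D4)
  refine this.congr_deriv ?_
  ext <;> simp <;> ring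

lemma Conn.dil {P Q : H} {L : ℝ} (h : Conn P Q L) {l : ℝ} (hl : 0 ≤ l) :
    Conn (Hdil l P) (Hdil l Q) (l * L) := by
  obtain ⟨γ, a, b, K, h1, h2, h3, h4, h5, h6⟩ := h
  have hL : ∃ C : NNReal, LipschitzWith C (fun p : H => Hdil l p) := by
    let m : H →L[ℝ] H := (l • ContinuousLinearMap.fst ℝ ℝ (ℝ × ℝ)).prod
      ((l • ((ContinuousLinearMap.fst ℝ ℝ ℝ).comp (ContinuousLinearMap.snd ℝ ℝ (ℝ × ℝ)))).prod
      (l^2 • ((ContinuousLinearMap.snd ℝ ℝ ℝ).comp (ContinuousLinearMap.snd ℝ ℝ (ℝ × ℝ)))))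
    refine ⟨‖m‖₊, ?_⟩
    exact m.lipschitz
  obtain ⟨C, hC⟩ := hL
  have e : (fun s => Real.sqrt ((l * a s)^2 + (l * b s)^2)) =
      fun s => l * Real.sqrt (a s ^2 + b s ^2) := by
    funext s
    rw [show (l * a s)^2 + (l * b s)^2 = l^2 * (a s^2 + b s^2) by ring,
      Real.sqrt_mul (by positivity), Real.sqrt_sq hl]
  refine ⟨fun s => Hdil l (γ s), fun s => l * a s, fun s => l * b s, C * K, hC.comp h1, by simp [h2],
    by simp [h3], ?_, ?_, ?_⟩
  · filter_upwards [h4] with s hs hs'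
    have D := hs hs'
    have D1 := hd1 D
    have D2 := hd2 D
    have D3 := hd3 D
    have := (D1.const_mul l).prodMk ((D2.const_mul l).prodMk (D3.const_mul (l^2)))
    refine this.congr_deriv ?_
    ext <;> simp [Hdil] <;> ring
  · rw [e]; exact h5.const_mul l
  · rw [e, intervalIntegral.integral_const_mul, h6]

lemma conn_line (x y : ℝ) : Conn HO (x, y, 0) (Real.sqrt (x^2 + y^2)) := by
  refine ⟨fun s => s • ((x, y, 0) : H), fun _ => x, fun _ => y, ‖((x,y,0) : H)‖₊, ?_, ?_, ?_, ?_, ?_, ?_⟩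
  · refine LipschitzWith.of_dist_le_mul fun s s' => ?_
    rw [dist_eq_norm, ← sub_smul, norm_smul, mul_comm, Real.dist_eq]; rfl
  · simp only [zero_smul]; rfl
  · simp
  · refine Filter.Eventually.of_forall fun s _ => ?_
    have := (hasDerivAt_id s).smul_const ((x, y, 0) : H)
    refine this.congr_deriv ?_
    ext <;> simp <;> ring
  · simp
  · simp
/-- Euclidean norm in the plane. -/
def nm (x y : ℝ) : ℝ := Real.sqrt (x^2 + y^2)

lemma nm_nonneg (x y : ℝ) : 0 ≤ nm x y := Real.sqrt_nonneg _

lemma nm_sq (x y : ℝ) : nm x y ^ 2 = x^2 + y^2 := Real.sq_sqrt (by positivity)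

lemma nm_inner (x y u v : ℝ) : x * u + y * v ≤ nm x y * nm u v := by
  have h1 := nm_nonneg x y
  have h2 := nm_nonneg u v
  refine le_of_abs_le (abs_le_of_sq_le_sq ?_ (mul_nonneg h1 h2))
  rw [mul_pow, nm_sq, nm_sq]
  nlinarith [sq_nonneg (x * v - y * u)]

lemma nm_le {x y c : ℝ} (hc : 0 ≤ c) (h : x^2 + y^2 ≤ c^2) : nm x y ≤ c :=
  Real.sqrt_le_iff.mpr ⟨hc, h⟩

lemma nm_neg (x y : ℝ) : nm (-x) (-y) = nm x y := by simp [nm]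

lemma nm_inner_abs (x y u v : ℝ) : |x * u + y * v| ≤ nm x y * nm u v := by
  rw [abs_le]
  constructor
  · have := nm_inner (-x) (-y) u v
    rw [nm_neg] at this; linarith
  · exact nm_inner x y u v

lemma nm_add (x y u v : ℝ) : nm (x + u) (y + v) ≤ nm x y + nm u v := by
  have h1 := nm_nonneg x y
  have h2 := nm_nonneg u v
  refine nm_le (by linarith) ?_
  nlinarith [nm_inner x y u v, nm_sq x y, nm_sq u v]

lemma nm_smul {c : ℝ} (hc : 0 ≤ c) (x y : ℝ) : nm (c * x) (c * y) = c * nm x y := by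
  rw [nm, nm, show (c * x)^2 + (c * y)^2 = c^2 * (x^2 + y^2) by ring, Real.sqrt_mul (by positivity),
    Real.sqrt_sq hc]

lemma Hmul_assoc (p q r : H) : Hmul (Hmul p q) r = Hmul p (Hmul q r) := by
  ext <;> simp [Hmul] <;> ring

lemma Hmul_O (p : H) : Hmul p HO = p := by ext <;> simp [Hmul, HO]
lemma O_Hmul (p : H) : Hmul HO p = p := by ext <;> simp [Hmul, HO]
lemma Hinv_Hmul (p : H) : Hmul (Hinv p) p = HO := by ext <;> simp [Hmul, HO, Hinv]
lemma Hmul_Hinv (p : H) : Hmul p (Hinv p) = HO := by ext <;> simp [Hmul, HO, Hinv]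

lemma Conn.mul {p q : H} {L L' : ℝ} (h : Conn HO p L) (h' : Conn HO q L') :
    Conn HO (Hmul p q) (L + L') := by
  have := h'.left p
  rw [Hmul_O] at this
  exact h.trans this

lemma conn_vert (t : ℝ) : Conn HO (0, 0, t) (2 * Real.sqrt |t|) := by
  obtain ⟨p, q, hpq, hp, hq⟩ : ∃ p q : ℝ, -4 * (p * q) = t ∧ |p| = Real.sqrt |t| / 2 ∧
      |q| = Real.sqrt |t| / 2 := by
    have h0 := Real.sqrt_nonneg |t|
    have h1 := Real.mul_self_sqrt (abs_nonneg t)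
    rcases le_total 0 t with h | h
    · refine ⟨Real.sqrt |t| / 2, -(Real.sqrt |t| / 2), ?_, ?_, ?_⟩
      · rw [abs_of_nonneg h] at *; linarith
      · exact abs_of_nonneg (by positivity)
      · rw [abs_neg]; exact abs_of_nonneg (by positivity)
    · refine ⟨Real.sqrt |t| / 2, (Real.sqrt |t| / 2), ?_, ?_, ?_⟩
      · rw [abs_of_nonpos h] at *; linarith
      · exact abs_of_nonneg (by positivity)
      · exact abs_of_nonneg (by positivity)
  have c1 := conn_line p 0
  have c2 := conn_line 0 q
  have c3 := conn_line (-p) 0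
  have c4 := conn_line 0 (-q)
  have := ((c1.mul c2).mul c3).mul c4
  have e : Hmul (Hmul (Hmul (p, 0, 0) (0, q, 0)) (-p, 0, 0)) (0, -q, 0) = ((0, 0, t) : H) := by
    ext <;> simp [Hmul]
    rw [← hpq]; ring
  rw [e] at this
  convert this using 1
  simp [Real.sqrt_sq_eq_abs, hp, hq]
  ring

lemma conn_O (Q : H) : Conn HO Q (nm Q.1 Q.2.1 + 2 * Real.sqrt |Q.2.2|) := by
  have := (conn_line Q.1 Q.2.1).mul (conn_vert Q.2.2)
  rwa [show Hmul (Q.1, Q.2.1, 0) (0, 0, Q.2.2) = Q by ext <;> simp [Hmul]] at this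

lemma conn_ex (P Q : H) : ∃ L, Conn P Q L := by
  have := (conn_O (Hmul (Hinv P) Q)).left P
  rw [Hmul_O, ← Hmul_assoc, Hmul_Hinv, O_Hmul] at this
  exact ⟨_, this⟩

lemma dH_le {P Q : H} {L : ℝ} (h : Conn P Q L) : dH P Q ≤ L := csInf_le (conn_bdd P Q) h

lemma le_dH {P Q : H} {c : ℝ} (h : ∀ L, Conn P Q L → c ≤ L) : c ≤ dH P Q :=
  le_csInf (conn_ex P Q) h

lemma dH_nonneg (P Q : H) : 0 ≤ dH P Q := le_dH fun _ h => h.nonneg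

lemma dH_tri (P Q R : H) : dH P R ≤ dH P Q + dH Q R := by
  have : dH P R - dH P Q ≤ dH Q R := le_dH fun L hL => by
    have : dH P R - L ≤ dH P Q := le_dH fun L' hL' => by
      have := dH_le (hL'.trans hL); linarith
    linarith
  linarith

lemma dH_left_le (g P Q : H) : dH (Hmul g P) (Hmul g Q) ≤ dH P Q :=
  le_dH fun _ h => dH_le (h.left g)

lemma dH_left (P Q : H) : dH P Q = dH HO (Hmul (Hinv P) Q) := by
  apply le_antisymm
  · have := dH_left_le P HO (Hmul (Hinv P) Q)
    rwa [Hmul_O, ← Hmul_assoc, Hmul_Hinv, O_Hmul] at this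
  · have := dH_left_le (Hinv P) P Q
    rwa [Hinv_Hmul] at this

lemma dH_mul (p q : H) : dH HO (Hmul p q) ≤ dH HO p + dH HO q := by
  refine (dH_tri HO p _).trans ?_
  rw [dH_left p, ← Hmul_assoc, Hinv_Hmul, O_Hmul]

lemma dH_O (Q : H) : dH HO Q ≤ nm Q.1 Q.2.1 + 2 * Real.sqrt |Q.2.2| := dH_le (conn_O Q)

lemma dH_line (x y : ℝ) : dH HO (x, y, 0) ≤ nm x y := dH_le (conn_line x y)

lemma dH_vert (t : ℝ) : dH HO (0, 0, t) ≤ 2 * Real.sqrt |t| := dH_le (conn_vert t)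

lemma dH_dil (p : H) {l : ℝ} (hl : 0 ≤ l) : dH HO (Hdil l p) ≤ l * dH HO p := by
  have key : ∀ L, Conn HO p L → dH HO (Hdil l p) ≤ l * L := by
    intro L h
    have := h.dil hl
    rw [show Hdil l HO = HO by ext <;> simp [Hdil, HO]] at this
    exact dH_le this
  rcases hl.eq_or_lt with h0 | h0
  · obtain ⟨L, hL⟩ := conn_ex HO p
    have := key L hL
    rw [← h0] at this ⊢; linarith
  · have : dH HO (Hdil l p) / l ≤ dH HO p := le_dH fun L hL => by
      rw [div_le_iff₀ h0]; linarith [key L hL]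
    rw [div_le_iff₀ h0] at this; linarith

lemma ftc {φ φ' ψ : ℝ → ℝ} {K : NNReal} (hφ : LipschitzWith K φ) {u : ℝ} (hu : 0 ≤ u)
    (h : ∀ᵐ s ∂volume, s ∈ Set.Icc (0:ℝ) u → HasDerivAt φ (φ' s) s ∧ φ' s ≤ ψ s)
    (hψ : IntervalIntegrable ψ volume 0 u) : φ u - φ 0 ≤ ∫ s in (0:ℝ)..u, ψ s := by
  have ac := (hφ.lipschitzOnWith (s := Set.uIcc 0 u)).absolutelyContinuousOnInterval
  rw [← ac.integral_deriv_eq_sub]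
  refine intervalIntegral.integral_mono_ae_restrict hu ac.intervalIntegrable_deriv hψ ?_
  rw [Filter.EventuallyLE, ae_restrict_iff' measurableSet_Icc]
  filter_upwards [h] with s hs hs'
  obtain ⟨h1, h2⟩ := hs hs'
  rw [h1.deriv]; exact h2

lemma lip1 {K : NNReal} {γ : ℝ → H} (h : LipschitzWith K γ) :
    LipschitzWith (1 * K) (fun s => (γ s).1) := LipschitzWith.prod_fst.comp h
lemma lip2 {K : NNReal} {γ : ℝ → H} (h : LipschitzWith K γ) :
    LipschitzWith (1 * (1 * K)) (fun s => (γ s).2.1) :=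
  LipschitzWith.prod_fst.comp (LipschitzWith.prod_snd.comp h)
lemma lip3 {K : NNReal} {γ : ℝ → H} (h : LipschitzWith K γ) :
    LipschitzWith (1 * (1 * K)) (fun s => (γ s).2.2) :=
  LipschitzWith.prod_snd.comp (LipschitzWith.prod_snd.comp h)

lemma lip_smul {K : NNReal} {φ : ℝ → ℝ} (h : LipschitzWith K φ) (c : ℝ) :
    LipschitzWith (‖c‖₊ * K) (fun s => c * φ s) := (lipschitzWith_smul c).comp h

lemma conn_ge {Q : H} {L : ℝ} (h : Conn HO Q L) : nm Q.1 Q.2.1 ≤ L ∧ |Q.2.2| ≤ 2 * L^2 := by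
  have hL := h.nonneg
  obtain ⟨γ, a, b, K, h1, h2, h3, h4, h5, h6⟩ := h
  have key : ∀ u ∈ Set.Icc (0:ℝ) 1, nm (γ u).1 (γ u).2.1 ≤ L := by
    intro u hu
    set α := (γ u).1
    set β := (γ u).2.1
    set r := nm α β with hr
    have i0 : IntervalIntegrable (fun s => r * Real.sqrt (a s ^ 2 + b s ^ 2)) volume 0 1 :=
      h5.const_mul r
    have hsub : Set.uIcc 0 u ⊆ Set.uIcc (0:ℝ) 1 := by
      rw [Set.uIcc_of_le hu.1, Set.uIcc_of_le zero_le_one]; exact Set.Icc_subset_Icc_right hu.2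
    have f := ftc (φ := fun s => α * (γ s).1 + β * (γ s).2.1)
      (φ' := fun s => α * a s + β * b s) (ψ := fun s => r * Real.sqrt (a s ^ 2 + b s ^ 2))
      ((lip_smul (lip1 h1) α).add (lip_smul (lip2 h1) β)) hu.1 (by
        filter_upwards [h4] with s hs hs'
        have D := hs ⟨hs'.1, hs'.2.trans hu.2⟩
        exact ⟨((hd1 D).const_mul α).add ((hd2 D).const_mul β), nm_inner α β (a s) (b s)⟩)
      (i0.mono_set hsub)
    have m : ∫ s in (0:ℝ)..u, r * Real.sqrt (a s ^ 2 + b s ^ 2) ≤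
        ∫ s in (0:ℝ)..1, r * Real.sqrt (a s ^ 2 + b s ^ 2) := by
      refine intervalIntegral.integral_mono_interval le_rfl hu.1 hu.2 ?_ i0
      exact Filter.Eventually.of_forall fun s => mul_nonneg (nm_nonneg _ _) (Real.sqrt_nonneg _)
    rw [intervalIntegral.integral_const_mul, intervalIntegral.integral_const_mul, ← h6] at m
    rw [intervalIntegral.integral_const_mul] at f
    simp only [h2, HO, mul_zero, add_zero, sub_zero] at f
    have e : r^2 = α^2 + β^2 := nm_sq _ _
    have hr0 : 0 ≤ r := nm_nonneg _ _
    have : α * (γ u).1 + β * (γ u).2.1 = r^2 := by rw [e]; ring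
    have g : r^2 ≤ r * L := by linarith
    rcases hr0.eq_or_lt with h0 | h0
    · rw [← h0]; exact hL
    · nlinarith
  refine ⟨by have := key 1 ⟨zero_le_one, le_rfl⟩; rwa [h3] at this, ?_⟩
  have i0 : IntervalIntegrable (fun s => (2 * L) * Real.sqrt (a s ^ 2 + b s ^ 2)) volume 0 1 :=
      h5.const_mul _
  have tb : ∀ c : ℝ, |c| = 1 → c * Q.2.2 ≤ 2 * L^2 := by
    intro c hc
    have f := ftc (φ := fun s => c * (γ s).2.2)
      (φ' := fun s => c * (2 * (γ s).2.1 * a s - 2 * (γ s).1 * b s))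
      (ψ := fun s => (2 * L) * Real.sqrt (a s ^ 2 + b s ^ 2))
      (lip_smul (lip3 h1) c) zero_le_one (by
        filter_upwards [h4] with s hs hs'
        refine ⟨(hd3 (hs hs')).const_mul c, ?_⟩
        have k := key s hs'
        have n1 := nm_inner_abs (γ s).2.1 (-(γ s).1) (a s) (b s)
        have e1 : nm (γ s).2.1 (-(γ s).1) = nm (γ s).1 (γ s).2.1 := by
          simp [nm, add_comm]
        rw [e1] at n1
        have n2 : nm (γ s).1 (γ s).2.1 * nm (a s) (b s) ≤ L * nm (a s) (b s) :=
          mul_le_mul_of_nonneg_right k (nm_nonneg _ _)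
        have n3 : c * (2 * (γ s).2.1 * a s - 2 * (γ s).1 * b s) ≤
            |c * (2 * (γ s).2.1 * a s - 2 * (γ s).1 * b s)| := le_abs_self _
        rw [abs_mul, hc, one_mul, show 2 * (γ s).2.1 * a s - 2 * (γ s).1 * b s =
          2 * ((γ s).2.1 * a s + -(γ s).1 * b s) by ring, abs_mul, abs_two] at n3
        have : nm (a s) (b s) = Real.sqrt (a s ^ 2 + b s ^ 2) := rfl
        rw [← this]
        calc _ ≤ _ := le_of_eq (by ring)
          _ ≤ _ := n3
          _ ≤ _ := by linarith)
      i0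
    rw [intervalIntegral.integral_const_mul, ← h6, h2, h3] at f
    simp only [HO, mul_zero, sub_zero] at f
    linarith
  rw [abs_le]
  have t1 := tb 1 (by simp)
  have t2 := tb (-1) (by simp)
  constructor <;> linarith

lemma nm_le_dH (Q : H) : nm Q.1 Q.2.1 ≤ dH HO Q := le_dH fun _ h => (conn_ge h).1

lemma t_le_dH (Q : H) : |Q.2.2| ≤ 2 * dH HO Q ^ 2 := by
  have h : Real.sqrt (|Q.2.2| / 2) ≤ dH HO Q := le_dH fun L h => by
    have := (conn_ge h).2
    exact Real.sqrt_le_iff.mpr ⟨h.nonneg, by linarith⟩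
  have := (Real.sqrt_le_iff.mp h).2
  linarith

lemma nm_sub_le_dH (P Q : H) : nm (Q.1 - P.1) (Q.2.1 - P.2.1) ≤ dH P Q := by
  rw [dH_left]
  refine le_trans (le_of_eq ?_) (nm_le_dH _)
  simp only [Hmul, Hinv]
  congr 1 <;> ring

lemma dH_shift (x y t τ : ℝ) (hD : 0 < dH HO (x, y, t)) :
    dH HO (x, y, t + τ) ≤ dH HO (x, y, t) + 16 * |τ| / dH HO (x, y, t) := by
  set D := dH HO (x, y, t) with hDdef
  have n0 := nm_nonneg x y
  have nD : nm x y ≤ D := nm_le_dH (x, y, t)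
  by_cases c : D / 4 ≤ nm x y
  · have np : 0 < nm x y := by linarith
    have n2 := nm_sq x y
    set k := τ / (4 * nm x y ^ 2) with hk
    have e : Hmul (Hmul (k * (-y), k * x, 0) (x, y, t)) (k * y, k * (-x), 0) = (x, y, t + τ) := by
      have : k * (4 * (x^2 + y^2)) = τ := by rw [hk, ← n2]; field_simp
      ext <;> simp [Hmul]
      rw [← this]; ring
    rw [← e]
    have l1 := dH_mul (Hmul (k * (-y), k * x, 0) (x, y, t)) (k * y, k * (-x), 0)
    have l2 := dH_mul (k * (-y), k * x, 0) (x, y, t)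
    have l3 := dH_line (k * (-y)) (k * x)
    have l4 := dH_line (k * y) (k * (-x))
    have e3 : nm (k * (-y)) (k * x) = |k| * nm x y := by
      rw [nm, nm, ← Real.sqrt_sq_eq_abs, ← Real.sqrt_mul (by positivity)]; congr 1; ring
    have e4 : nm (k * y) (k * (-x)) = |k| * nm x y := by
      rw [nm, nm, ← Real.sqrt_sq_eq_abs, ← Real.sqrt_mul (by positivity)]; congr 1; ring
    have e5 : |k| * nm x y = |τ| / (4 * nm x y) := by
      rw [hk, abs_div, abs_of_pos (by positivity : 0 < 4 * nm x y ^2)]; field_simp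
    have e6 : |τ| / (4 * nm x y) ≤ |τ| / D :=
      div_le_div_of_nonneg_left (abs_nonneg _) hD (by linarith)
    have e7 : 16 * |τ| / D = 16 * (|τ| / D) := by ring
    have e8 : 0 ≤ |τ| / D := by positivity
    linarith
  · push Not at c
    have b1 : D ≤ nm x y + 2 * Real.sqrt |t| := dH_O (x, y, t)
    have s0 := Real.sqrt_nonneg |t|
    have s1 := Real.sq_sqrt (abs_nonneg t)
    have b2 : 3 * D / 8 ≤ Real.sqrt |t| := by linarith
    have b3 : D^2 / 8 ≤ |t| := by nlinarith
    have hv : dH HO (x, y, t + τ) ≤ D + 2 * Real.sqrt |τ| := by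
      have := dH_mul (x, y, t) (0, 0, τ)
      rw [show Hmul (x, y, t) (0, 0, τ) = (x, y, t + τ) by ext <;> simp [Hmul]] at this
      linarith [dH_vert τ]
    by_cases c2 : |t| ≤ |τ|
    · have r0 : Real.sqrt |t| ≤ Real.sqrt |τ| := Real.sqrt_le_sqrt c2
      have r1 := Real.sq_sqrt (abs_nonneg τ)
      have : 2 * Real.sqrt |τ| ≤ 16 * |τ| / D := by
        rw [le_div_iff₀ hD]
        nlinarith [Real.sqrt_nonneg |τ|]
      linarith
    · push Not at c2
      have tp : 0 < |t| := by nlinarith [abs_nonneg τ]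
      have t0 : t ≠ 0 := abs_pos.mp tp
      have q : |τ / t| ≤ 1 := by
        rw [abs_div, div_le_one tp]; exact c2.le
      have q0 : 0 ≤ 1 + τ / t := by linarith [(abs_le.mp q).1]
      set l := Real.sqrt (1 + τ / t) with hl
      have l0 : 0 ≤ l := Real.sqrt_nonneg _
      have l2 : l^2 = 1 + τ / t := Real.sq_sqrt q0
      have l1 : |l - 1| ≤ |τ / t| := by
        have : τ / t = (l - 1) * (l + 1) := by linarith
        rw [this, abs_mul, abs_of_nonneg (by linarith : 0 ≤ l + 1)]
        nlinarith [abs_nonneg (l - 1)]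
      have e : Hmul (Hdil l (x, y, t)) ((1 - l) * x, (1 - l) * y, 0) = (x, y, t + τ) := by
        have : l^2 * t = t + τ := by rw [l2]; field_simp
        ext <;> simp [Hmul, Hdil] <;> linarith
      rw [← e]
      have k1 := dH_mul (Hdil l (x, y, t)) ((1 - l) * x, (1 - l) * y, 0)
      have k2 := dH_dil (x, y, t) l0
      have k3 := dH_line ((1 - l) * x) ((1 - l) * y)
      have k4 : nm ((1 - l) * x) ((1 - l) * y) = |l - 1| * nm x y := by
        rw [nm, nm, ← Real.sqrt_sq_eq_abs, ← Real.sqrt_mul (by positivity)]; congr 1; ring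
      have k5 : |l - 1| * nm x y ≤ |τ / t| * D := by
        apply mul_le_mul l1 nD n0 (abs_nonneg _)
      have k6 : l * D ≤ D + |τ / t| * D := by nlinarith [le_abs_self (l - 1)]
      have k7 : |τ / t| * D ≤ 8 * |τ| / D := by
        rw [abs_div, le_div_iff₀ hD, div_mul_eq_mul_div, div_mul_eq_mul_div, div_le_iff₀ tp]
        nlinarith [abs_nonneg τ]
      have k8 : 16 * |τ| / D = 2 * (8 * |τ| / D) := by ring
      linarith

lemma bl_up {ε : ℝ} {f : H → H} (hf : IsBiLip ε f) (hO : f HO = HO) (P : H) :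
    dH HO (f P) ≤ (1 + ε) * dH HO P := by
  have := (hf HO P).2; rwa [hO] at this

lemma bl_low {ε : ℝ} (hε : 0 ≤ ε) {f : H → H} (hf : IsBiLip ε f) (P Q : H) :
    dH P Q ≤ (1 + ε) * dH (f P) (f Q) := by
  have := (hf P Q).1
  rwa [inv_mul_le_iff₀ (by linarith)] at this

lemma bl_mono {ε ε' : ℝ} (hε : 0 ≤ ε) (h : ε ≤ ε') {f : H → H} (hf : IsBiLip ε f) :
    IsBiLip ε' f := by
  intro P Q
  have h0 := dH_nonneg P Q
  refine ⟨le_trans ?_ (hf P Q).1, (hf P Q).2.trans ?_⟩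
  · apply mul_le_mul_of_nonneg_right _ h0
    apply inv_anti₀ <;> linarith
  · apply mul_le_mul_of_nonneg_right _ h0; linarith

lemma dH_seg {vx vy : ℝ} (hv : vx^2 + vy^2 = 1) {M : ℝ} (hM : 0 ≤ M) :
    dH HO (M * vx, M * vy, 0) ≤ M := by
  have := dH_line (M * vx) (M * vy)
  rwa [nm_smul hM, nm, hv, Real.sqrt_one, mul_one] at this

lemma star0 {ε : ℝ} (hε : 0 ≤ ε) (hε1 : ε ≤ 1) {f : H → H} (hf : IsBiLip ε f) (hO : f HO = HO)
    {vx vy : ℝ} (hv : vx^2 + vy^2 = 1) {M N ρ : ℝ} (hM : 0 < M) (hN : 2 * M ≤ N) (hρ : 0 < ρ)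
    (P : H) (hP : dH HO P ≤ ρ) :
    M - (P.1 * vx + P.2.1 * vy) - 3 * ε * N - 2 * ε * (M + ρ) - 1536 * (M^2 + ρ^2) / N ≤
      nm ((f (M * vx, M * vy, 0)).1 - (f P).1) ((f (M * vx, M * vy, 0)).2.1 - (f P).2.1) := by
  have hNp : 0 < N := by linarith
  set S := f (M * vx, M * vy, 0) with hS
  set Q := f (N * vx, N * vy, 0) with hQ
  set p := f P with hp
  have nv : nm vx vy = 1 := by rw [nm, hv, Real.sqrt_one]
  -- lower bound
  have l1 : N - (P.1 * vx + P.2.1 * vy) ≤ dH P (N * vx, N * vy, 0) := by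
    have h1 := nm_sub_le_dH P (N * vx, N * vy, 0)
    have h2 := nm_inner (N * vx - P.1) (N * vy - P.2.1) vx vy
    rw [nv, mul_one] at h2
    simp only at h1
    have : (N * vx - P.1) * vx + (N * vy - P.2.1) * vy = N * (vx^2 + vy^2) - (P.1 * vx + P.2.1 * vy) := by
      ring
    rw [hv] at this
    linarith
  have l2 := bl_low hε hf P (N * vx, N * vy, 0)
  rw [← hp, ← hQ] at l2
  -- D'
  set D := dH S Q with hD
  have g1 : dH (M * vx, M * vy, 0) (N * vx, N * vy, 0) ≤ N - M := by
    rw [dH_left]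
    have := dH_seg hv (by linarith : 0 ≤ N - M)
    convert this using 2
    ext <;> simp [Hmul, Hinv] <;> ring
  have g2 : N - M ≤ dH (M * vx, M * vy, 0) (N * vx, N * vy, 0) := by
    have h1 := nm_sub_le_dH (M * vx, M * vy, 0) (N * vx, N * vy, 0)
    simp only at h1
    rw [← sub_mul, ← sub_mul, nm_smul (by linarith), nv] at h1
    linarith
  have g3 := bl_low hε hf (M * vx, M * vy, 0) (N * vx, N * vy, 0)
  have g4 := (hf (M * vx, M * vy, 0) (N * vx, N * vy, 0)).2
  rw [← hS, ← hQ, ← hD] at g3 g4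
  have D0 : 0 ≤ D := dH_nonneg _ _
  have D1 : N / 4 ≤ D := by
    have h1 := mul_le_mul_of_nonneg_right (by linarith : 1 + ε ≤ 2) D0
    linarith
  have D2 : D ≤ (1 + ε) * (N - M) := g4.trans (mul_le_mul_of_nonneg_left g1 (by linarith))
  -- sizes
  have s1 : dH HO S ≤ 2 * M := by
    have := bl_up hf hO (M * vx, M * vy, 0)
    have h2 := dH_seg hv hM.le
    rw [← hS] at this
    have h3 := mul_le_mul_of_nonneg_right (by linarith : 1 + ε ≤ 2)
      (dH_nonneg HO (M * vx, M * vy, 0))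
    linarith
  have p1 : dH HO p ≤ 2 * ρ := by
    have := bl_up hf hO P
    rw [← hp] at this
    have h3 := mul_le_mul_of_nonneg_right (by linarith : 1 + ε ≤ 2) (dH_nonneg HO P)
    linarith
  have s2 := nm_le_dH S
  have p2 := nm_le_dH p
  have s3 := t_le_dH S
  have p3 := t_le_dH p
  have s0 := dH_nonneg HO S
  have p0 := dH_nonneg HO p
  set w1 := S.1 - p.1 with hw1
  set w2 := S.2.1 - p.2.1 with hw2
  set τ := S.2.2 - p.2.2 - 2 * (S.1 * p.2.1 - p.1 * S.2.1) with hτ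
  have τb : |τ| ≤ 12 * (M^2 + ρ^2) := by
    have a1 := nm_inner_abs S.1 S.2.1 p.2.1 (-p.1)
    have a2 : nm p.2.1 (-p.1) = nm p.1 p.2.1 := by simp [nm, add_comm]
    rw [a2] at a1
    have a3 : nm S.1 S.2.1 * nm p.1 p.2.1 ≤ (2 * M) * (2 * ρ) :=
      mul_le_mul (by linarith) (by linarith) (nm_nonneg _ _) (by linarith)
    have a4 := a1.trans a3
    have a5 : dH HO S ^ 2 ≤ (2 * M)^2 := by gcongr
    have a6 : dH HO p ^ 2 ≤ (2 * ρ)^2 := by gcongr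
    have sq := sq_nonneg (M - ρ)
    rw [abs_le] at a4 s3 p3 ⊢
    constructor <;> linarith
  have up : dH p Q ≤ nm w1 w2 + D + 16 * |τ| / D := by
    set Q' := Hmul (Hinv S) Q with hQ'
    have hDQ : D = dH HO (Q'.1, Q'.2.1, Q'.2.2) := by rw [hD, dH_left]
    have e : Hmul (Hinv p) Q = Hmul (w1, w2, 0) (Q'.1, Q'.2.1, Q'.2.2 + τ) := by
      ext <;> simp [Hmul, Hinv, hQ', hw1, hw2, hτ] <;> ring
    rw [dH_left p Q, e]
    have u1 := dH_mul (w1, w2, 0) (Q'.1, Q'.2.1, Q'.2.2 + τ)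
    have u2 := dH_line w1 w2
    have u3 := dH_shift Q'.1 Q'.2.1 Q'.2.2 τ (by rw [← hDQ]; linarith)
    rw [← hDQ] at u3
    linarith
  have t1 : 16 * |τ| / D ≤ 768 * (M^2 + ρ^2) / N := by
    rw [div_le_div_iff₀ (by linarith) hNp]
    have : 0 ≤ M^2 + ρ^2 := by positivity
    calc 16 * |τ| * N ≤ 16 * (12 * (M^2 + ρ^2)) * N := by gcongr
      _ = 768 * (M^2 + ρ^2) * (N / 4) := by ring
      _ ≤ _ := by gcongr
  have n1 : nm w1 w2 ≤ 2 * (M + ρ) := by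
    have := nm_add S.1 S.2.1 (-p.1) (-p.2.1)
    rw [nm_neg, ← sub_eq_add_neg, ← sub_eq_add_neg] at this
    linarith
  set X := (M^2 + ρ^2) / N with hX
  have X0 : 0 ≤ X := by positivity
  have e1 : 768 * (M^2 + ρ^2) / N = 768 * X := by rw [hX]; ring
  have e2 : 1536 * (M^2 + ρ^2) / N = 1536 * X := by rw [hX]; ring
  rw [e2]
  rw [e1] at t1
  have fin : N - (P.1 * vx + P.2.1 * vy) ≤
      (1 + ε) * (nm w1 w2 + (1 + ε) * (N - M) + 768 * X) := by
    refine (l1.trans l2).trans (mul_le_mul_of_nonneg_left ?_ (by linarith))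
    linarith
  have n0 := nm_nonneg w1 w2
  have f1 : ε * nm w1 w2 ≤ ε * (2 * (M + ρ)) := mul_le_mul_of_nonneg_left n1 hε
  have f2 : ε * X ≤ 1 * X := mul_le_mul_of_nonneg_right hε1 X0
  have f3 : (1 + ε) * (1 + ε) * (N - M) ≤ (N - M) + 3 * ε * N := by
    have h1 := mul_le_mul_of_nonneg_left hε1 hε
    have h2 : (1 + ε) * (1 + ε) ≤ 1 + 3 * ε := by linarith
    have h0 : 0 ≤ N - M := by linarith
    have h3 := mul_le_mul_of_nonneg_right h2 h0
    linarith [mul_nonneg hε hM.le]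
  linarith

lemma star {r : ℝ} (hr : 0 < r) (hr1 : r ≤ 1) {f : H → H} (hf : IsBiLip (r^2) f) (hO : f HO = HO)
    {vx vy : ℝ} (hv : vx^2 + vy^2 = 1) {M ρ : ℝ} (hM : 0 < M) (hρ : 0 < ρ)
    (P : H) (hP : dH HO P ≤ ρ) :
    M - (P.1 * vx + P.2.1 * vy) - 800 * r * (M + ρ) ≤
      nm ((f (M * vx, M * vy, 0)).1 - (f P).1) ((f (M * vx, M * vy, 0)).2.1 - (f P).2.1) := by
  have r2 : r^2 ≤ 1 := by nlinarith
  have hN : 2 * M ≤ 2 * (M + ρ) / r := by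
    rw [le_div_iff₀ hr]; nlinarith
  refine le_trans ?_ (star0 (by positivity) r2 hf hO hv hM hN hρ P hP)
  have e1 : 3 * r^2 * (2 * (M + ρ) / r) = 6 * r * (M + ρ) := by field_simp; ring
  have e2 : 1536 * (M^2 + ρ^2) / (2 * (M + ρ) / r) ≤ 768 * r * (M + ρ) := by
    rw [div_le_iff₀ (by positivity)]
    have : 768 * r * (M + ρ) * (2 * (M + ρ) / r) = 1536 * (M + ρ)^2 := by field_simp; ring
    rw [this]
    nlinarith [mul_pos hM hρ]
  have e3 : 2 * r^2 * (M + ρ) ≤ 2 * r * (M + ρ) := by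
    have : r^2 ≤ r := by nlinarith
    have : 0 < M + ρ := by linarith
    nlinarith
  nlinarith [mul_pos hr hM, mul_pos hr hρ]

/-- One-sided Busemann estimate. -/
lemma buse {q : ℝ} (hq : 0 < q) (hq1 : q ≤ 1/100) {f : H → H} (hf : IsBiLip (q^8) f)
    (hO : f HO = HO)
    {vx vy : ℝ} (hv : vx^2 + vy^2 = 1) {M ρ : ℝ} (hM : 0 < M) (hρ : 0 < ρ) (hMρ : M * q^2 = ρ)
    (P : H) (hP : dH HO P ≤ ρ) :
    (f (M * vx, M * vy, 0)).1 * (f P).1 + (f (M * vx, M * vy, 0)).2.1 * (f P).2.1 ≤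
      M * (P.1 * vx + P.2.1 * vy) + M * (1604 * ρ * q^2) := by
  have nv : nm vx vy = 1 := by rw [nm, hv, Real.sqrt_one]
  have q8 : q^8 = (q^4)^2 := by ring
  have q2 : q^2 ≤ 1/10000 := by nlinarith
  have q20 : 0 < q^2 := by positivity
  have q4 : q^4 = q^2 * q^2 := by ring
  have q4b : q^4 ≤ q^2 := by rw [q4]; nlinarith
  have q8b : q^8 ≤ q^2 := by
    calc q^8 = q^2 * q^6 := by ring
      _ ≤ q^2 * 1 := by
        gcongr
        exact pow_le_one₀ hq.le (by linarith)
      _ = q^2 := mul_one _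
  have st := star (r := q^4) (by positivity) (by linarith) (by rw [← q8]; exact hf) hO hv hM hρ P hP
  have up := bl_up hf hO (M * vx, M * vy, 0)
  have up2 := dH_seg hv hM.le
  have w0 := nm_le_dH (f (M * vx, M * vy, 0))
  have z0 := bl_up hf hO P
  have z1 := nm_le_dH (f P)
  set w := f (M * vx, M * vy, 0)
  set ζ := f P
  have hz : nm P.1 P.2.1 ≤ ρ := (nm_le_dH P).trans hP
  have hs := (abs_le.mp (nm_inner_abs P.1 P.2.1 vx vy))
  rw [nv, mul_one] at hs
  set s := P.1 * vx + P.2.1 * vy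
  have E : 800 * q^4 * (M + ρ) ≤ 1600 * ρ * q^2 := by
    have : q^4 * M = q^2 * ρ := by rw [← hMρ]; ring
    have : q^4 * ρ ≤ q^2 * ρ := by gcongr
    linarith
  have hMbig : 10000 * ρ ≤ M := by
    have := mul_le_mul_of_nonneg_left q2 hM.le
    linarith
  have Eb : 1600 * ρ * q^2 ≤ ρ := by
    have := mul_le_mul_of_nonneg_left q2 hρ.le
    linarith
  have B0 : 0 ≤ M - s - 1600 * ρ * q^2 := by linarith
  have B1 : M - s - 1600 * ρ * q^2 ≤ nm (w.1 - ζ.1) (w.2.1 - ζ.2.1) := by linarith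
  have B2 : (M - s - 1600 * ρ * q^2)^2 ≤ nm (w.1 - ζ.1) (w.2.1 - ζ.2.1)^2 := by gcongr
  rw [nm_sq] at B2
  have w1 : nm w.1 w.2.1 ≤ (1 + q^8) * M := by
    refine w0.trans (up.trans ?_); gcongr
  have w2 : nm w.1 w.2.1 ^2 ≤ ((1 + q^8) * M)^2 := by gcongr; exact nm_nonneg _ _
  rw [nm_sq] at w2
  have ζ1 : nm ζ.1 ζ.2.1 ≤ 2 * ρ := by
    refine z1.trans (z0.trans ?_)
    have h3 := mul_le_mul_of_nonneg_right (by linarith : 1 + q^8 ≤ 2) (dH_nonneg HO P)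
    linarith
  have ζ2 : nm ζ.1 ζ.2.1 ^2 ≤ (2 * ρ)^2 := by gcongr; exact nm_nonneg _ _
  rw [nm_sq] at ζ2
  have k1 : ((1 + q^8) * M)^2 ≤ M^2 + 3 * q^8 * M^2 := by
    have h0 : 0 ≤ q^8 := by positivity
    have h1 : q^8 ≤ 1 := by linarith
    generalize q^8 = e at h0 h1 ⊢
    have h2 : e * e ≤ e * 1 := mul_le_mul_of_nonneg_left h1 h0
    have h3 := mul_le_mul_of_nonneg_right h2 (sq_nonneg M)
    linarith
  have k2 : q^8 * M^2 ≤ M * (ρ * q^2) := by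
    have h1 : q^8 * M^2 = q^4 * (M * (ρ * q^2)) := by rw [← hMρ]; ring
    rw [h1]
    have h2 : 0 < M * (ρ * q^2) := by positivity
    have h3 := mul_le_mul_of_nonneg_right (by linarith : q^4 ≤ 1) h2.le
    linarith
  have k3 : ρ^2 = M * (ρ * q^2) := by rw [← hMρ]; ring
  set Y := ρ * q^2 with hY
  have hY2 : 1600 * ρ * q^2 = 1600 * Y := by rw [hY]; ring
  have hY3 : 1604 * ρ * q^2 = 1604 * Y := by rw [hY]; ring
  rw [hY2] at B2
  rw [hY3]
  have h9 := sq_nonneg (s + 1600 * Y)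
  have h10 : 0 < M * Y := by positivity
  clear_value s Y w ζ
  clear st up up2 w0 z0 z1 hs E hMbig Eb B0 B1 w1 ζ1 hz hY hY2 hY3
  linarith

/-- Two-sided estimate. -/
lemma buse2 {q : ℝ} (hq : 0 < q) (hq1 : q ≤ 1/100) {f : H → H} (hf : IsBiLip (q^8) f)
    (hO : f HO = HO)
    {vx vy : ℝ} (hv : vx^2 + vy^2 = 1) {ρ : ℝ} (hρ : 0 < ρ) :
    ∃ ax ay : ℝ, nm ax ay ≤ 1 + q^8 ∧ ∀ P : H, dH HO P ≤ ρ →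
      |ax * (f P).1 + ay * (f P).2.1 - (P.1 * vx + P.2.1 * vy)| ≤ 1800 * ρ * q^2 := by
  have q20 : 0 < q^2 := by positivity
  have q2 : q^2 ≤ 1/10000 := by nlinarith
  set M := ρ / q^2 with hMd
  have hM : 0 < M := by positivity
  have hMρ : M * q^2 = ρ := by rw [hMd]; field_simp
  have hv' : (-vx)^2 + (-vy)^2 = 1 := by rw [← hv]; ring
  have up := (nm_le_dH _).trans ((bl_up hf hO (M * vx, M * vy, 0)).trans
    (mul_le_mul_of_nonneg_left (dH_seg hv hM.le) (by positivity)))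
  have up' := (nm_le_dH _).trans ((bl_up hf hO (M * (-vx), M * (-vy), 0)).trans
    (mul_le_mul_of_nonneg_left (dH_seg hv' hM.le) (by positivity)))
  have q8 : q^8 = (q^4)^2 := by ring
  have q41 : q^4 ≤ 1 := pow_le_one₀ hq.le (by linarith)
  have st := star (r := q^4) (by positivity) q41 (by rw [← q8]; exact hf)
    hO hv hM hM (M * (-vx), M * (-vy), 0) (dH_seg hv' hM.le)
  have b1 := fun P hP => buse hq hq1 hf hO hv hM hρ hMρ P hP
  have b2 := fun P hP => buse hq hq1 hf hO hv' hM hρ hMρ P hP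
  set w := f (M * vx, M * vy, 0)
  set u := f (M * (-vx), M * (-vy), 0)
  simp only at st
  have st2 : M * (2 - 1600 * q^4) ≤ nm (w.1 - u.1) (w.2.1 - u.2.1) := by
    have : M * -vx * vx + M * -vy * vy = -M := by
      have : M * -vx * vx + M * -vy * vy = -M * (vx^2 + vy^2) := by ring
      rw [this, hv, mul_one]
    rw [this] at st
    linarith
  have q4 : q^4 = q^2 * q^2 := by ring
  have q4b : q^4 ≤ 1/100000000 := by rw [q4]; nlinarith
  have st3 : (M * (2 - 1600 * q^4))^2 ≤ nm (w.1 - u.1) (w.2.1 - u.2.1)^2 := by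
    have : 0 ≤ M * (2 - 1600 * q^4) := mul_nonneg hM.le (by linarith)
    gcongr
  have up2 : nm w.1 w.2.1 ^2 ≤ ((1 + q^8) * M)^2 := by gcongr; exact nm_nonneg _ _
  have up2' : nm u.1 u.2.1 ^2 ≤ ((1 + q^8) * M)^2 := by gcongr; exact nm_nonneg _ _
  have sum : nm (w.1 + u.1) (w.2.1 + u.2.1) ≤ M * (81 * q^2) := by
    apply nm_le (by positivity)
    rw [nm_sq] at st3 up2 up2'
    have c1 : 4 * (1 + q^8)^2 - (2 - 1600 * q^4)^2 ≤ (81 * q^2)^2 := by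
      rw [q8]
      have : 0 ≤ q^4 := by positivity
      have e : (81 * q^2)^2 = 6561 * q^4 := by ring
      rw [e]
      generalize q^4 = Z at *
      nlinarith [mul_nonneg this (by linarith : 0 ≤ 1/100000000 - Z),
        mul_nonneg (mul_nonneg this this) (by linarith : 0 ≤ 1/100000000 - Z),
        mul_nonneg (mul_nonneg (mul_nonneg this this) this) (by linarith : 0 ≤ 1/100000000 - Z)]
    have c2 := mul_le_mul_of_nonneg_left c1 (sq_nonneg M)
    linarith
  refine ⟨w.1 / M, w.2.1 / M, ?_, ?_⟩
  · rw [div_eq_inv_mul, div_eq_inv_mul, nm_smul (by positivity), inv_mul_le_iff₀ hM]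
    linarith
  · intro P hP
    have h1 := b1 P hP
    have h2 := b2 P hP
    have h3 := (abs_le.mp (nm_inner_abs (w.1 + u.1) (w.2.1 + u.2.1) (f P).1 (f P).2.1))
    have z : nm (f P).1 (f P).2.1 ≤ 2 * ρ := by
      refine (nm_le_dH _).trans ((bl_up hf hO P).trans ?_)
      have h5 : q^8 ≤ 1 := pow_le_one₀ hq.le (by linarith)
      have h6 := mul_le_mul_of_nonneg_right (by linarith : 1 + q^8 ≤ 2) (dH_nonneg HO P)
      linarith
    have h4 : nm (w.1 + u.1) (w.2.1 + u.2.1) * nm (f P).1 (f P).2.1 ≤ M * (81 * q^2) * (2 * ρ) :=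
      mul_le_mul sum z (nm_nonneg _ _) (by positivity)
    have e : w.1 / M * (f P).1 + w.2.1 / M * (f P).2.1 - (P.1 * vx + P.2.1 * vy) =
      (w.1 * (f P).1 + w.2.1 * (f P).2.1 - M * (P.1 * vx + P.2.1 * vy)) / M := by field_simp
    rw [e, abs_div, abs_of_pos hM, div_le_iff₀ hM, abs_le]
    have h5 : 0 < M * (ρ * q^2) := by positivity
    clear_value w u
    clear b1 b2 st st2 st3 up up' up2 up2' sum e
    constructor <;> linarith [h3.1, h3.2]

lemma step1a {q : ℝ} (hq : 0 < q) (hq1 : q ≤ 1/100) {f : H → H} (hf : IsBiLip (q^8) f)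
    (hO : f HO = HO)
    {vx vy : ℝ} (hv : vx^2 + vy^2 = 1) {ρ : ℝ} (hρ : 0 < ρ) (P : H) (hP : dH HO P ≤ ρ) :
    |(f (ρ * vx, ρ * vy, 0)).1 * (f P).1 + (f (ρ * vx, ρ * vy, 0)).2.1 * (f P).2.1
      - ρ * (P.1 * vx + P.2.1 * vy)| ≤ 2000 * ρ^2 * q := by
  obtain ⟨ax, ay, ha, hb⟩ := buse2 hq hq1 hf hO hv hρ
  have seg := dH_seg hv hρ.le
  have h1 := (abs_le.mp (hb _ seg)).1
  have h2 := hb P hP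
  have up := (nm_le_dH _).trans ((bl_up hf hO (ρ * vx, ρ * vy, 0)).trans
    (mul_le_mul_of_nonneg_left seg (by positivity)))
  set b := f (ρ * vx, ρ * vy, 0)
  simp only at h1
  have e1 : ρ * vx * vx + ρ * vy * vy = ρ := by
    have : ρ * vx * vx + ρ * vy * vy = ρ * (vx^2 + vy^2) := by ring
    rw [this, hv, mul_one]
  rw [e1] at h1
  have q8b : q^8 ≤ q^2/1000 := by
    calc q^8 = q^2 * q^6 := by ring
      _ ≤ q^2 * (1/100)^6 := by gcongr
      _ ≤ q^2/1000 := by nlinarith [sq_nonneg q]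
  have q81 : q^8 ≤ 1 := pow_le_one₀ hq.le (by linarith)
  have n1 : nm ax ay ^2 ≤ (1 + q^8)^2 := by gcongr; exact nm_nonneg _ _
  have n2 : nm b.1 b.2.1 ^2 ≤ ((1 + q^8) * ρ)^2 := by gcongr; exact nm_nonneg _ _
  rw [nm_sq] at n1 n2
  have dif : nm (b.1 - ρ * ax) (b.2.1 - ρ * ay) ≤ 61 * q * ρ := by
    apply nm_le (by positivity)
    have c1 : (1 + q^8)^2 ≤ 1 + 3 * q^8 := by nlinarith [pow_pos hq 8]
    have c2 : (1 + q^8)^2 ≤ 1 + q^2 := by linarith [sq_nonneg q]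
    have c3 : ((1 + q^8) * ρ)^2 ≤ (1 + q^2) * ρ^2 := by
      rw [mul_pow]; gcongr
    have c4 : ρ^2 * (ax^2 + ay^2) ≤ ρ^2 * (1 + q^2) :=
      mul_le_mul_of_nonneg_left (by linarith) (by positivity)
    have c5 := mul_le_mul_of_nonneg_left h1 hρ.le
    have c6 : 0 < ρ^2 * q^2 := by positivity
    clear_value b
    linarith
  have z : nm (f P).1 (f P).2.1 ≤ 2 * ρ := by
    refine (nm_le_dH _).trans ((bl_up hf hO P).trans ?_)
    have h6 := mul_le_mul_of_nonneg_right (by linarith : 1 + q^8 ≤ 2) (dH_nonneg HO P)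
    linarith
  have h3 := (nm_inner_abs (b.1 - ρ * ax) (b.2.1 - ρ * ay) (f P).1 (f P).2.1)
  have h4 : nm (b.1 - ρ * ax) (b.2.1 - ρ * ay) * nm (f P).1 (f P).2.1 ≤ 61 * q * ρ * (2 * ρ) :=
    mul_le_mul dif z (nm_nonneg _ _) (by positivity)
  have e : b.1 * (f P).1 + b.2.1 * (f P).2.1 - ρ * (P.1 * vx + P.2.1 * vy) =
    ((b.1 - ρ * ax) * (f P).1 + (b.2.1 - ρ * ay) * (f P).2.1) +
    ρ * (ax * (f P).1 + ay * (f P).2.1 - (P.1 * vx + P.2.1 * vy)) := by ring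
  rw [e]
  refine (abs_add_le _ _).trans ?_
  rw [abs_mul, abs_of_pos hρ]
  have h5 := mul_le_mul_of_nonneg_left h2 hρ.le
  have : ρ^2 * q^2 ≤ ρ^2 * q * (1/100) := by
    have h6 : 0 < ρ^2 * q := by positivity
    have h7 := mul_le_mul_of_nonneg_left hq1 h6.le
    linarith
  have h6 : 0 < ρ^2 * q := by positivity
  linarith

lemma step1b {q : ℝ} (hq : 0 ≤ q) (hq1 : q ≤ 1/100) {f : H → H} (hf : IsBiLip (q^8) f)
    (hO : f HO = HO)
    {vx vy : ℝ} (hv : vx^2 + vy^2 = 1) {ρ : ℝ} (hρ : 0 < ρ) (P : H) (hP : dH HO P ≤ ρ) :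
    |(f (ρ * vx, ρ * vy, 0)).1 * (f P).1 + (f (ρ * vx, ρ * vy, 0)).2.1 * (f P).2.1
      - ρ * (P.1 * vx + P.2.1 * vy)| ≤ 2000 * ρ^2 * q := by
  rcases hq.eq_or_lt with h | h
  · subst h
    rw [mul_zero]
    refine le_of_forall_pos_le_add fun δ hδ => ?_
    rw [zero_add]
    set q := min (1/100) (δ / (2000 * ρ^2)) with hqd
    have hq : 0 < q := lt_min (by norm_num) (by positivity)
    have := step1a hq (min_le_left _ _) (bl_mono (by norm_num) (by
      rw [zero_pow (by norm_num)]; positivity) hf) hO hv hρ P hP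
    refine this.trans ?_
    have h2 : q ≤ δ / (2000 * ρ^2) := min_le_right _ _
    rw [le_div_iff₀ (by positivity)] at h2
    linarith
  · exact step1a h hq1 hf hO hv hρ P hP

lemma step1 {q : ℝ} (hq : 0 ≤ q) (hq1 : q ≤ 1/100000) {f : H → H} (hf : IsBiLip (q^8) f)
    (hO : f HO = HO) {ρ : ℝ} (hρ : 0 < ρ) :
    ∃ c d s : ℝ, c^2 + d^2 = 1 ∧ s^2 = 1 ∧ ∀ P : H, dH HO P ≤ ρ →
      |c * (f P).1 + d * (f P).2.1 - P.1| ≤ 14000 * q * ρ ∧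
      |(-(s * d)) * (f P).1 + (s * c) * (f P).2.1 - P.2.1| ≤ 14000 * q * ρ := by
  have q100 : q ≤ 1/100 := by linarith
  have A1 := fun P hP => step1b hq q100 hf hO (by norm_num : (1:ℝ)^2 + 0^2 = 1) hρ P hP
  have A2 := fun P hP => step1b hq q100 hf hO (by norm_num : (0:ℝ)^2 + 1^2 = 1) hρ P hP
  have S1 := dH_seg (by norm_num : (1:ℝ)^2 + 0^2 = 1) hρ.le
  have S2 := dH_seg (by norm_num : (0:ℝ)^2 + 1^2 = 1) hρ.le
  have B11 := A1 _ S1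
  have B12 := A1 _ S2
  have B22 := A2 _ S2
  set θ := 2000 * q with hθ
  have θ0 : 0 ≤ θ := by positivity
  have θ1 : θ ≤ 1/50 := by linarith
  set b1 := f (ρ * 1, ρ * 0, 0)
  set b2 := f (ρ * 0, ρ * 1, 0)
  obtain ⟨x1, hx1⟩ : ∃ x, b1.1 = ρ * x := ⟨b1.1 / ρ, by field_simp⟩
  obtain ⟨y1, hy1⟩ : ∃ x, b1.2.1 = ρ * x := ⟨b1.2.1 / ρ, by field_simp⟩
  obtain ⟨x2, hx2⟩ : ∃ x, b2.1 = ρ * x := ⟨b2.1 / ρ, by field_simp⟩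
  obtain ⟨y2, hy2⟩ : ∃ x, b2.2.1 = ρ * x := ⟨b2.2.1 / ρ, by field_simp⟩
  simp only [hx1, hy1, hx2, hy2] at A1 A2 B11 B12 B22
  have ρ2 : 0 < ρ^2 := by positivity
  have scale : ∀ X : ℝ, |ρ^2 * X| ≤ 2000 * ρ^2 * q → |X| ≤ θ := by
    intro X hX
    rw [abs_mul, abs_of_pos ρ2] at hX
    have : ρ^2 * |X| ≤ ρ^2 * θ := by rw [hθ]; linarith
    exact le_of_mul_le_mul_left this ρ2
  have C11 : |x1^2 + y1^2 - 1| ≤ θ := scale _ (by convert B11 using 2; ring)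
  have C12 : |x1 * x2 + y1 * y2| ≤ θ := scale _ (by convert B12 using 2; ring)
  have C22 : |x2^2 + y2^2 - 1| ≤ θ := scale _ (by convert B22 using 2; ring)
  clear B11 B12 B22
  set n := nm x1 y1 with hn
  have n0 : 0 ≤ n := nm_nonneg _ _
  have n2 : n^2 = x1^2 + y1^2 := nm_sq _ _
  rw [← n2] at C11
  have n1 : |n - 1| ≤ θ := by
    have : |n^2 - 1| = |n - 1| * (n + 1) := by
      rw [show n^2 - 1 = (n - 1) * (n + 1) by ring, abs_mul, abs_of_nonneg (by linarith : 0 ≤ n + 1)]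
    have h1 := mul_nonneg (abs_nonneg (n - 1)) n0
    linarith
  have n1' := abs_le.mp n1
  have np : 0 < n := by linarith
  obtain ⟨c, hc⟩ : ∃ c, x1 = n * c := ⟨x1 / n, by field_simp⟩
  obtain ⟨d, hd⟩ : ∃ c, y1 = n * c := ⟨y1 / n, by field_simp⟩
  have cd : c^2 + d^2 = 1 := by
    rw [hc, hd] at n2
    have : n^2 * (c^2 + d^2) = n^2 * 1 := by linarith
    exact mul_left_cancel₀ (by positivity) this
  set k := c * x2 + d * y2 with hk
  set m := -d * x2 + c * y2 with hm
  have km : k^2 + m^2 = x2^2 + y2^2 := by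
    have : k^2 + m^2 = (c^2 + d^2) * (x2^2 + y2^2) := by rw [hk, hm]; ring
    rw [this, cd, one_mul]
  have k1 : |k| ≤ 2 * θ := by
    have : x1 * x2 + y1 * y2 = n * k := by rw [hk, hc, hd]; ring
    rw [this, abs_mul, abs_of_pos np] at C12
    have h1 := mul_le_mul_of_nonneg_right (by linarith : 1/2 ≤ n) (abs_nonneg k)
    linarith
  have k2 : k^2 ≤ 4 * θ^2 := by
    have h1 : |k|^2 ≤ (2 * θ)^2 := by gcongr
    rw [sq_abs] at h1
    linarith
  have θ2 : θ^2 ≤ θ / 50 := by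
    have h1 := mul_le_mul_of_nonneg_left θ1 θ0
    linarith
  have C22' := abs_le.mp C22
  obtain ⟨s, hs, ms⟩ : ∃ s : ℝ, s^2 = 1 ∧ (m - s)^2 ≤ (2 * θ)^2 := by
    have key : ∀ m' : ℝ, 0 ≤ m' → m'^2 = m^2 → (m' - 1)^2 ≤ (2 * θ)^2 := by
      intro m' h0 h1
      have u1 : m'^2 ≤ (1 + θ)^2 := by linarith [sq_nonneg k, sq_nonneg θ]
      have u2 : (1 - 2 * θ)^2 ≤ m'^2 := by linarith
      have u3 : m' ≤ 1 + θ := le_of_abs_le (abs_le_of_sq_le_sq u1 (by linarith))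
      have u4 : 1 - 2 * θ ≤ m' := le_of_abs_le (abs_le_of_sq_le_sq u2 h0)
      exact sq_le_sq' (by linarith) (by linarith)
    rcases le_total 0 m with h | h
    · exact ⟨1, by norm_num, key m h rfl⟩
    · refine ⟨-1, by norm_num, ?_⟩
      have := key (-m) (by linarith) (by ring)
      linarith
  refine ⟨c, d, s, cd, hs, fun P hP => ?_⟩
  have z : nm (f P).1 (f P).2.1 ≤ 2 * ρ := by
    refine (nm_le_dH _).trans ((bl_up hf hO P).trans ?_)
    have h5 : q^8 ≤ 1 := pow_le_one₀ hq (by linarith)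
    have h6 := mul_le_mul_of_nonneg_right (by linarith : 1 + q^8 ≤ 2) (dH_nonneg HO P)
    linarith
  set ζ := f P
  have θe : 14000 * q * ρ = 7 * θ * ρ := by rw [hθ]; ring
  rw [θe]
  have fin : ∀ bx bY cx cY p : ℝ, |ρ * bx * ζ.1 + ρ * bY * ζ.2.1 - ρ * p| ≤ 2000 * ρ^2 * q →
      nm (cx - bx) (cY - bY) ≤ 3 * θ → |cx * ζ.1 + cY * ζ.2.1 - p| ≤ 7 * θ * ρ := by
    intro bx bY cx cY p h1 h2
    have h3 := nm_inner_abs (cx - bx) (cY - bY) ζ.1 ζ.2.1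
    have h4 : nm (cx - bx) (cY - bY) * nm ζ.1 ζ.2.1 ≤ 3 * θ * (2 * ρ) :=
      mul_le_mul h2 z (nm_nonneg _ _) (by positivity)
    have h5 : |bx * ζ.1 + bY * ζ.2.1 - p| ≤ θ * ρ := by
      rw [show ρ * bx * ζ.1 + ρ * bY * ζ.2.1 - ρ * p = ρ * (bx * ζ.1 + bY * ζ.2.1 - p) by ring,
        abs_mul, abs_of_pos hρ] at h1
      refine le_of_mul_le_mul_left ?_ hρ
      rw [hθ]; linarith
    rw [show cx * ζ.1 + cY * ζ.2.1 - p = ((cx - bx) * ζ.1 + (cY - bY) * ζ.2.1) +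
      (bx * ζ.1 + bY * ζ.2.1 - p) by ring]
    refine (abs_add_le _ _).trans ?_
    linarith
  constructor
  · refine fin x1 y1 c d P.1 (by convert A1 P hP using 2; ring) ?_
    apply nm_le (by positivity)
    have : (c - x1)^2 + (d - y1)^2 = (n - 1)^2 * (c^2 + d^2) := by rw [hc, hd]; ring
    rw [this, cd, mul_one]
    exact sq_le_sq' (by linarith) (by linarith)
  · refine fin x2 y2 (-(s * d)) (s * c) P.2.1 (by convert A2 P hP using 2; ring) ?_
    apply nm_le (by positivity)
    have : (-(s * d) - x2)^2 + (s * c - y2)^2 = k^2 + (m - s)^2 := by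
      have e : (-(s * d) - x2)^2 + (s * c - y2)^2 = s^2 * (c^2 + d^2) + (x2^2 + y2^2) - 2 * s * m := by
        rw [hm]; ring
      rw [e, cd, ← km, hs]
      linarith
    rw [this]
    linarith [sq_nonneg θ]

def hh (ex ey s : ℝ) : H := (s * ex, s * ey, 0)

lemma hh_add (ex ey s r : ℝ) (P : H) :
    Hmul (Hmul P (hh ex ey s)) (hh ex ey r) = Hmul P (hh ex ey (s + r)) := by
  ext <;> simp [Hmul, hh] <;> ring

lemma hh_zero (ex ey : ℝ) (P : H) : Hmul P (hh ex ey 0) = P := by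
  ext <;> simp [Hmul, hh]

lemma hh_dH {ex ey : ℝ} (he : ex^2 + ey^2 = 1) (s : ℝ) : dH HO (hh ex ey s) ≤ |s| := by
  rcases le_total 0 s with h | h
  · rw [abs_of_nonneg h]; exact dH_seg he h
  · rw [abs_of_nonpos h]
    have := dH_seg (vx := -ex) (vy := -ey) (by rw [← he]; ring) (by linarith : 0 ≤ -s)
    simpa [hh] using this

lemma hh_dist {ex ey : ℝ} (he : ex^2 + ey^2 = 1) (P : H) (s r : ℝ) :
    dH (Hmul P (hh ex ey s)) (Hmul P (hh ex ey r)) ≤ |r - s| := by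
  have h1 := dH_left_le (Hmul P (hh ex ey s)) HO (hh ex ey (r - s))
  have h2 : Hmul (Hmul P (hh ex ey s)) HO = Hmul P (hh ex ey s) := Hmul_O _
  rw [h2, hh_add] at h1
  rw [show s + (r - s) = r by ring] at h1
  exact h1.trans (hh_dH he _)

lemma nm_lip {ε : ℝ} (hε : 0 ≤ ε) {f : H → H} (hf : IsBiLip ε f) {ex ey : ℝ}
    (he : ex^2 + ey^2 = 1) (P : H) (s r : ℝ) :
    nm ((f (Hmul P (hh ex ey r))).1 - (f (Hmul P (hh ex ey s))).1)
      ((f (Hmul P (hh ex ey r))).2.1 - (f (Hmul P (hh ex ey s))).2.1) ≤ (1 + ε) * |r - s| :=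
  (nm_sub_le_dH _ _).trans ((hf _ _).2.trans
    (mul_le_mul_of_nonneg_left (hh_dist he P s r) (by linarith)))

lemma pansu_deriv {f : H → H} {J : Matrix (Fin 2) (Fin 2) ℝ} {ex ey s : ℝ} {P : H}
    (h : HasPansuJacobianAt f J (Hmul P (hh ex ey s))) :
    HasDerivAt (fun r => (f (Hmul P (hh ex ey r))).1) (J 0 0 * ex + J 0 1 * ey) s ∧
    HasDerivAt (fun r => (f (Hmul P (hh ex ey r))).2.1) (J 1 0 * ex + J 1 1 * ey) s := by
  have key : ∀ δ : ℝ, 0 < δ → ∃ σ₀ > (0:ℝ), ∀ t : ℝ, t ≠ 0 → |t| < σ₀ →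
      |t⁻¹ * ((f (Hmul P (hh ex ey (s + t)))).1 - (f (Hmul P (hh ex ey s))).1)
        - (J 0 0 * ex + J 0 1 * ey)| < δ ∧
      |t⁻¹ * ((f (Hmul P (hh ex ey (s + t)))).2.1 - (f (Hmul P (hh ex ey s))).2.1)
        - (J 1 0 * ex + J 1 1 * ey)| < δ := by
    intro δ hδ
    obtain ⟨σ₀, h0, h1⟩ := h {((ex, ey, 0) : H), ((-ex, -ey, 0) : H)} (Set.toFinite _).isCompact δ hδ
    refine ⟨σ₀, h0, fun t ht htσ => ?_⟩
    rcases lt_or_gt_of_ne ht with hn | hp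
    · rw [abs_of_neg hn] at htσ
      have h2 := h1 (-t) (by linarith) htσ (-ex, -ey, 0) (by simp)
      have e : Hdil (-t) (-ex, -ey, 0) = hh ex ey t := by
        ext <;> simp [Hdil, hh]
      rw [e, hh_add, Prod.dist_eq, Prod.dist_eq, max_lt_iff, max_lt_iff] at h2
      obtain ⟨h3, h4, -⟩ := h2
      rw [Real.dist_eq] at h3 h4
      generalize f (Hmul P (hh ex ey s)) = u0 at h3 h4 ⊢
      generalize f (Hmul P (hh ex ey (s + t))) = u1 at h3 h4 ⊢
      simp only [Hdil, Hmul, Hinv] at h3 h4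
      rw [← abs_neg] at h3 h4
      rw [inv_neg] at h3 h4
      constructor
      · refine lt_of_eq_of_lt (congrArg _ ?_) h3; ring
      · refine lt_of_eq_of_lt (congrArg _ ?_) h4; ring
    · rw [abs_of_pos hp] at htσ
      have h2 := h1 t hp htσ (ex, ey, 0) (by simp)
      have e : Hdil t (ex, ey, 0) = hh ex ey t := by
        ext <;> simp [Hdil, hh]
      rw [e, hh_add, Prod.dist_eq, Prod.dist_eq, max_lt_iff, max_lt_iff] at h2
      obtain ⟨h3, h4, -⟩ := h2
      rw [Real.dist_eq] at h3 h4
      generalize f (Hmul P (hh ex ey s)) = u0 at h3 h4 ⊢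
      generalize f (Hmul P (hh ex ey (s + t))) = u1 at h3 h4 ⊢
      simp only [Hdil, Hmul, Hinv] at h3 h4
      constructor
      · refine lt_of_eq_of_lt (congrArg _ ?_) h3; ring
      · refine lt_of_eq_of_lt (congrArg _ ?_) h4; ring
  constructor
  · rw [hasDerivAt_iff_tendsto_slope_zero, Metric.tendsto_nhdsWithin_nhds]
    intro δ hδ
    obtain ⟨σ₀, h0, h1⟩ := key δ hδ
    refine ⟨σ₀, h0, fun t ht htσ => ?_⟩
    rw [Real.dist_eq, sub_zero] at htσ
    rw [Real.dist_eq]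
    exact (h1 t ht htσ).1
  · rw [hasDerivAt_iff_tendsto_slope_zero, Metric.tendsto_nhdsWithin_nhds]
    intro δ hδ
    obtain ⟨σ₀, h0, h1⟩ := key δ hδ
    refine ⟨σ₀, h0, fun t ht htσ => ?_⟩
    rw [Real.dist_eq, sub_zero] at htσ
    rw [Real.dist_eq]
    exact (h1 t ht htσ).2

lemma pansu_bound {ε : ℝ} (hε : 0 ≤ ε) {f : H → H} (hf : IsBiLip ε f)
    {J : Matrix (Fin 2) (Fin 2) ℝ} {ex ey s : ℝ} (he : ex^2 + ey^2 = 1) {P : H}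
    (h : HasPansuJacobianAt f J (Hmul P (hh ex ey s))) :
    nm (J 0 0 * ex + J 0 1 * ey) (J 1 0 * ex + J 1 1 * ey) ≤ 1 + ε := by
  obtain ⟨h1, h2⟩ := pansu_deriv h
  rw [hasDerivAt_iff_tendsto_slope_zero] at h1 h2
  have h3 : Filter.Tendsto (fun t : ℝ => nm
      (t⁻¹ • ((f (Hmul P (hh ex ey (s + t)))).1 - (f (Hmul P (hh ex ey s))).1))
      (t⁻¹ • ((f (Hmul P (hh ex ey (s + t)))).2.1 - (f (Hmul P (hh ex ey s))).2.1)))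
      (nhdsWithin 0 {0}ᶜ) (nhds (nm (J 0 0 * ex + J 0 1 * ey) (J 1 0 * ex + J 1 1 * ey))) :=
    ((h1.pow 2).add (h2.pow 2)).sqrt
  refine le_of_tendsto h3 ?_
  filter_upwards [self_mem_nhdsWithin] with t ht
  have ht0 : 0 < |t| := abs_pos.mpr ht
  have h4 := nm_lip hε hf he P s (s + t)
  rw [add_sub_cancel_left] at h4
  have h5 : ∀ a b : ℝ, nm (t⁻¹ • a) (t⁻¹ • b) = |t|⁻¹ * nm a b := by
    intro a b
    simp only [nm, smul_eq_mul]
    rw [show (t⁻¹ * a)^2 + (t⁻¹ * b)^2 = (|t|⁻¹)^2 * (a^2 + b^2) by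
      rw [inv_pow, sq_abs]; ring, Real.sqrt_mul (sq_nonneg _), Real.sqrt_sq (by positivity)]
  rw [h5, inv_mul_le_iff₀ ht0]
  linarith

lemma nm_meas {α : Type*} [MeasurableSpace α] {a b : α → ℝ} (ha : Measurable a)
    (hb : Measurable b) : Measurable fun x => nm (a x) (b x) :=
  ((ha.pow_const 2).add (hb.pow_const 2)).sqrt

lemma path_meas (ex ey : ℝ) : Measurable fun p : H × ℝ => Hmul p.1 (hh ex ey p.2) := by
  have : Continuous fun p : H × ℝ => Hmul p.1 (hh ex ey p.2) := by
    unfold Hmul hh; fun_prop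
  exact this.measurable

lemma line_est {ε : ℝ} (hε : 0 ≤ ε) (hε1 : ε ≤ 1) {f : H → H} (hf : IsBiLip ε f)
    {Jf : H → Matrix (Fin 2) (Fin 2) ℝ} (hJ : ∀ i j : Fin 2, Measurable fun P : H => Jf P i j)
    {ex ey cx cy : ℝ} (he : ex^2 + ey^2 = 1) (hc : cx^2 + cy^2 = 1) {R δ κ : ℝ} (hR : 0 < R)
    (hκ : 0 < κ) (P : H)
    (hP : ∀ᵐ s ∂(volume : Measure ℝ),
      HasPansuJacobianAt f (Jf (Hmul P (hh ex ey s))) (Hmul P (hh ex ey s)))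
    (hδ : R - δ ≤ (cx * (f (Hmul P (hh ex ey R))).1 + cy * (f (Hmul P (hh ex ey R))).2.1) -
      (cx * (f P).1 + cy * (f P).2.1))
    (hκδ : 3 * ε * R + 2 * δ ≤ κ^2 * R) :
    ∫⁻ s in Set.Icc 0 R, ENNReal.ofReal (nm
      (Jf (Hmul P (hh ex ey s)) 0 0 * ex + Jf (Hmul P (hh ex ey s)) 0 1 * ey - cx)
      (Jf (Hmul P (hh ex ey s)) 1 0 * ex + Jf (Hmul P (hh ex ey s)) 1 1 * ey - cy))
      ≤ ENNReal.ofReal (κ * R) := by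
  set D : ℝ → ℝ := fun s => nm
      (Jf (Hmul P (hh ex ey s)) 0 0 * ex + Jf (Hmul P (hh ex ey s)) 0 1 * ey - cx)
      (Jf (Hmul P (hh ex ey s)) 1 0 * ex + Jf (Hmul P (hh ex ey s)) 1 1 * ey - cy) with hD
  have pm : Measurable fun s : ℝ => Hmul P (hh ex ey s) :=
    (path_meas ex ey).comp (measurable_const.prodMk measurable_id)
  have jm : ∀ i j, Measurable fun s : ℝ => Jf (Hmul P (hh ex ey s)) i j :=
    fun i j => (hJ i j).comp pm
  have Dm : Measurable D := nm_meas
    ((((jm 0 0).mul_const ex).add ((jm 0 1).mul_const ey)).sub_const cx)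
    ((((jm 1 0).mul_const ex).add ((jm 1 1).mul_const ey)).sub_const cy)
  have D0 : ∀ s, 0 ≤ D s := fun s => nm_nonneg _ _
  have nc : nm cx cy = 1 := by rw [nm, hc, Real.sqrt_one]
  have Db : ∀ᵐ s ∂(volume : Measure ℝ), D s ≤ 3 := by
    filter_upwards [hP] with s hs
    have h1 := pansu_bound hε hf he hs
    have h2 := nm_add (Jf (Hmul P (hh ex ey s)) 0 0 * ex + Jf (Hmul P (hh ex ey s)) 0 1 * ey)
      (Jf (Hmul P (hh ex ey s)) 1 0 * ex + Jf (Hmul P (hh ex ey s)) 1 1 * ey) (-cx) (-cy)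
    rw [nm_neg, nc, ← sub_eq_add_neg, ← sub_eq_add_neg] at h2
    simp only [hD]
    linarith
  have Di : IntegrableOn D (Set.Icc 0 R) volume := by
    refine Measure.integrableOn_of_bounded (M := 3) (by simp) Dm.aestronglyMeasurable ?_
    refine ae_restrict_of_ae ?_
    filter_upwards [Db] with s hs
    rwa [Real.norm_of_nonneg (D0 s)]
  have Dii : IntervalIntegrable D volume 0 R :=
    (intervalIntegrable_iff_integrableOn_Icc_of_le hR.le).mpr Di
  have L1 : ∀ s r, |(f (Hmul P (hh ex ey r))).1 - (f (Hmul P (hh ex ey s))).1| ≤ 2 * |r - s| ∧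
      |(f (Hmul P (hh ex ey r))).2.1 - (f (Hmul P (hh ex ey s))).2.1| ≤ 2 * |r - s| := by
    intro s r
    have h1 := nm_lip hε hf he P s r
    have h2 : ∀ a b : ℝ, |a| ≤ nm a b ∧ |b| ≤ nm a b := by
      intro a b
      constructor
      · apply Real.abs_le_sqrt; linarith [sq_nonneg b]
      · apply Real.abs_le_sqrt; linarith [sq_nonneg a]
    have h3 := mul_le_mul_of_nonneg_right (by linarith : 1 + ε ≤ 2) (abs_nonneg (r - s))
    exact ⟨(h2 _ _).1.trans (h1.trans h3), (h2 _ _).2.trans (h1.trans h3)⟩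
  have lipφ : LipschitzWith (Real.toNNReal 4) (fun r =>
      cx * (f (Hmul P (hh ex ey r))).1 + cy * (f (Hmul P (hh ex ey r))).2.1) := by
    apply LipschitzWith.of_dist_le_mul
    intro r s
    rw [Real.dist_eq, Real.dist_eq, Real.coe_toNNReal _ (by norm_num)]
    obtain ⟨h1, h2⟩ := L1 s r
    have c1 : |cx| ≤ 1 := abs_le_one_iff_mul_self_le_one.mpr (by linarith [sq_nonneg cy])
    have c2 : |cy| ≤ 1 := abs_le_one_iff_mul_self_le_one.mpr (by linarith [sq_nonneg cx])
    generalize (f (Hmul P (hh ex ey r))).1 = a1 at *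
    generalize (f (Hmul P (hh ex ey s))).1 = a2 at *
    generalize (f (Hmul P (hh ex ey r))).2.1 = b1 at *
    generalize (f (Hmul P (hh ex ey s))).2.1 = b2 at *
    rw [show cx * a1 + cy * b1 - (cx * a2 + cy * b2) = cx * (a1 - a2) + cy * (b1 - b2) by ring]
    refine (abs_add_le _ _).trans ?_
    rw [abs_mul, abs_mul]
    have := mul_le_mul c1 h1 (abs_nonneg _) (by norm_num)
    have := mul_le_mul c2 h2 (abs_nonneg _) (by norm_num)
    linarith
  have main := ftc lipφ hR.le (φ' := fun s =>
      cx * (Jf (Hmul P (hh ex ey s)) 0 0 * ex + Jf (Hmul P (hh ex ey s)) 0 1 * ey)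
      + cy * (Jf (Hmul P (hh ex ey s)) 1 0 * ex + Jf (Hmul P (hh ex ey s)) 1 1 * ey))
    (ψ := fun s => ((1 + ε)^2 + 1 + κ^2) / 2 - κ * D s) (by
      filter_upwards [hP] with s hs _
      obtain ⟨h1, h2⟩ := pansu_deriv hs
      refine ⟨(h1.const_mul cx).add (h2.const_mul cy), ?_⟩
      have h3 := pansu_bound hε hf he hs
      have h4 : D s ^ 2 = _ := nm_sq _ _
      have h5 := nm_sq (Jf (Hmul P (hh ex ey s)) 0 0 * ex + Jf (Hmul P (hh ex ey s)) 0 1 * ey)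
        (Jf (Hmul P (hh ex ey s)) 1 0 * ex + Jf (Hmul P (hh ex ey s)) 1 1 * ey)
      have h6 : nm (Jf (Hmul P (hh ex ey s)) 0 0 * ex + Jf (Hmul P (hh ex ey s)) 0 1 * ey)
        (Jf (Hmul P (hh ex ey s)) 1 0 * ex + Jf (Hmul P (hh ex ey s)) 1 1 * ey) ^ 2 ≤ (1 + ε)^2 := by
        have := nm_nonneg (Jf (Hmul P (hh ex ey s)) 0 0 * ex + Jf (Hmul P (hh ex ey s)) 0 1 * ey)
          (Jf (Hmul P (hh ex ey s)) 1 0 * ex + Jf (Hmul P (hh ex ey s)) 1 1 * ey)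
        gcongr
      have h7 := sq_nonneg (D s - κ)
      generalize D s = d at *
      generalize Jf (Hmul P (hh ex ey s)) 0 0 * ex + Jf (Hmul P (hh ex ey s)) 0 1 * ey = a at *
      generalize Jf (Hmul P (hh ex ey s)) 1 0 * ex + Jf (Hmul P (hh ex ey s)) 1 1 * ey = b at *
      linarith)
    (intervalIntegrable_const.sub (Dii.const_mul κ))
  rw [intervalIntegral.integral_sub intervalIntegrable_const (Dii.const_mul κ),
    intervalIntegral.integral_const, intervalIntegral.integral_const_mul, smul_eq_mul,
    sub_zero] at main
  simp only [hh_zero] at main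
  rw [← ofReal_integral_eq_lintegral_ofReal Di (Filter.Eventually.of_forall D0)]
  apply ENNReal.ofReal_le_ofReal
  rw [integral_Icc_eq_integral_Ioc, ← intervalIntegral.integral_of_le hR.le]
  have h2 : R * (ε * ε) ≤ R * (ε * 1) := by gcongr
  have h3 : κ * ∫ s in (0:ℝ)..R, D s ≤ κ * (κ * R) := by linarith
  exact le_of_mul_le_mul_left h3 hκ

lemma mp_right (g : H) : MeasurePreserving (fun P : H => Hmul P g) volume volume := by
  have h1 : ∀ c : ℝ, MeasurePreserving (fun x : ℝ => x + c) volume volume :=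
    fun c => measurePreserving_add_right volume c
  unfold Hmul
  refine MeasurePreserving.skew_product (μa := volume) (μb := volume) (μc := volume) (μd := volume)
    (g := fun (x : ℝ) (q : ℝ × ℝ) => (q.1 + g.2.1, q.2 + g.2.2 + 2 * (g.1 * q.1 - x * g.2.1)))
    (h1 g.1) (Continuous.measurable (by fun_prop)) ?_
  refine Filter.Eventually.of_forall fun x => ?_
  refine (MeasurePreserving.skew_product (μa := volume) (μb := volume) (μc := volume) (μd := volume)
    (g := fun (y t : ℝ) => t + g.2.2 + 2 * (g.1 * y - x * g.2.1))
    (h1 g.2.1) (Continuous.measurable (by fun_prop)) ?_).map_eq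
  refine Filter.Eventually.of_forall fun y => ?_
  have := (h1 (g.2.2 + 2 * (g.1 * y - x * g.2.1))).map_eq
  simpa only [add_assoc] using this

lemma ball_open (R : ℝ) : IsOpen {Q : H | dH HO Q < R} := by
  rw [isOpen_iff_mem_nhds]
  intro Q₀ hQ
  have hc : Continuous fun Q : H => dH HO Q₀ + (nm (Hmul (Hinv Q₀) Q).1 (Hmul (Hinv Q₀) Q).2.1
      + 2 * Real.sqrt |(Hmul (Hinv Q₀) Q).2.2|) := by
    unfold nm Hmul; fun_prop
  have : IsOpen {Q : H | dH HO Q₀ + (nm (Hmul (Hinv Q₀) Q).1 (Hmul (Hinv Q₀) Q).2.1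
      + 2 * Real.sqrt |(Hmul (Hinv Q₀) Q).2.2|) < R} := isOpen_lt hc continuous_const
  refine Filter.mem_of_superset (this.mem_nhds ?_) ?_
  · have h0 : Hmul (Hinv Q₀) Q₀ = HO := Hinv_Hmul _
    simp only [Set.mem_ofPred_eq, h0]
    simpa [HO, nm] using hQ
  · intro Q h
    simp only [Set.mem_ofPred_eq] at h ⊢
    have h1 := dH_tri HO Q₀ Q
    have h2 := dH_O (Hmul (Hinv Q₀) Q)
    rw [← dH_left] at h2
    linarith

lemma ball_vol (R : ℝ) :
    volume {Q : H | dH HO Q < 2 * R} ≤ 16 * volume {Q : H | dH HO Q < R} := by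
  have hsub : {Q : H | dH HO Q < 2 * R} ⊆ (Hdil (1/2)) ⁻¹' {Q : H | dH HO Q < R} := by
    intro Q hQ
    simp only [Set.mem_ofPred_eq, Set.mem_preimage] at hQ ⊢
    have := dH_dil Q (by norm_num : (0:ℝ) ≤ 1/2)
    linarith
  refine (measure_mono hsub).trans (le_of_eq ?_)
  have hm : Measurable (Hdil (1/2)) :=
    (show Continuous (Hdil (1/2)) by unfold Hdil; fun_prop).measurable
  rw [← Measure.map_apply hm (ball_open R).measurableSet]
  have e : Hdil (1/2) = Prod.map (fun x : ℝ => 1/2 * x)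
      (Prod.map (fun x : ℝ => 1/2 * x) (fun x : ℝ => (1/2)^2 * x)) := by
    funext p; rfl
  have mm : ∀ a : ℝ, Measurable fun x : ℝ => a * x := fun a => measurable_const_mul a
  have v : (volume : Measure H) = (volume : Measure ℝ).prod
    ((volume : Measure ℝ).prod (volume : Measure ℝ)) := rfl
  have : Measure.map (Hdil (1/2)) (volume : Measure H) = (16 : ENNReal) • (volume : Measure H) := by
    rw [v, e, ← Measure.map_prod_map _ _ (mm _) ((mm _).prodMap (mm _)),
      ← Measure.map_prod_map _ _ (mm _) (mm _),
      Real.map_volume_mul_left (by norm_num : (1/2 : ℝ) ≠ 0),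
      Real.map_volume_mul_left (by norm_num : ((1/2)^2 : ℝ) ≠ 0)]
    simp only [Measure.prod_smul_left, Measure.prod_smul_right, smul_smul]
    congr 1
    rw [← ENNReal.ofReal_mul (by positivity), ← ENNReal.ofReal_mul (by positivity)]
    norm_num
  rw [this]
  rfl

lemma dir_est {q : ℝ} (hq : 0 ≤ q) (hq1 : q ≤ 1) {f : H → H} (hf : IsBiLip (q^8) f)
    {Jf : H → Matrix (Fin 2) (Fin 2) ℝ} (hJ : ∀ i j : Fin 2, Measurable fun P : H => Jf P i j)
    (hae : ∀ᵐ P ∂(volume : Measure H), HasPansuJacobianAt f (Jf P) P)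
    {ex ey cx cy : ℝ} (he : ex^2 + ey^2 = 1) (hc : cx^2 + cy^2 = 1) {R κ : ℝ} (hR : 0 < R)
    (hκ : 0 < κ) (hκq : 250000 * q ≤ κ^2)
    (h1 : ∀ P : H, dH HO P ≤ 4 * R →
      |cx * (f P).1 + cy * (f P).2.1 - (ex * P.1 + ey * P.2.1)| ≤ 14000 * q * (4 * R)) :
    ∫⁻ Q in {Q : H | dH HO Q < R}, ENNReal.ofReal (nm
      (Jf Q 0 0 * ex + Jf Q 0 1 * ey - cx) (Jf Q 1 0 * ex + Jf Q 1 1 * ey - cy))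
      ≤ ENNReal.ofReal (16 * κ) * volume {Q : H | dH HO Q < R} := by
  set G : H → ENNReal := fun Q => ENNReal.ofReal (nm
      (Jf Q 0 0 * ex + Jf Q 0 1 * ey - cx) (Jf Q 1 0 * ex + Jf Q 1 1 * ey - cy)) with hG
  have Gm : Measurable G := (nm_meas
    ((((hJ 0 0).mul_const ex).add ((hJ 0 1).mul_const ey)).sub_const cx)
    ((((hJ 1 0).mul_const ex).add ((hJ 1 1).mul_const ey)).sub_const cy)).ennreal_ofReal
  have q80 : 0 ≤ q^8 := by positivity
  have q8 : q^8 ≤ q := by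
    calc q^8 = q * q^7 := by ring
      _ ≤ q * 1 := by gcongr; exact pow_le_one₀ hq hq1
      _ = q := mul_one q
  set B := {Q : H | dH HO Q < R} with hB
  set B2 := {Q : H | dH HO Q < 2 * R} with hB2
  have Bm : MeasurableSet B := (ball_open R).measurableSet
  have B2m : MeasurableSet B2 := (ball_open (2 * R)).measurableSet
  have pm := path_meas ex ey
  -- a.e. lines
  have aeP : ∀ᵐ P ∂(volume : Measure H), ∀ᵐ s ∂(volume : Measure ℝ),
      HasPansuJacobianAt f (Jf (Hmul P (hh ex ey s))) (Hmul P (hh ex ey s)) := by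
    set N := toMeasurable (volume : Measure H) {P | ¬ HasPansuJacobianAt f (Jf P) P} with hN
    have N0 : volume N = 0 := by rw [hN, measure_toMeasurable]; exact hae
    have Nm : MeasurableSet N := measurableSet_toMeasurable _ _
    have hs : ∀ᵐ s ∂(volume : Measure ℝ), ∀ᵐ P ∂(volume : Measure H),
        Hmul P (hh ex ey s) ∉ N := by
      refine Filter.Eventually.of_forall fun s => ?_
      have := (mp_right (hh ex ey s)).quasiMeasurePreserving.ae
        (p := fun Q => Q ∉ N) (measure_eq_zero_iff_ae_notMem.mp N0)
      exact this
    have sw := (Measure.ae_ae_comm (μ := (volume : Measure H)) (ν := (volume : Measure ℝ))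
      (p := fun P s => Hmul P (hh ex ey s) ∉ N) (pm Nm.compl)).mpr hs
    filter_upwards [sw] with P hP
    filter_upwards [hP] with s hs
    by_contra hcon
    exact hs (subset_toMeasurable _ _ hcon)
  have inner : ∀ᵐ P ∂(volume : Measure H), P ∈ B2 →
      ∫⁻ s in Set.Icc 0 R, G (Hmul P (hh ex ey s)) ≤ ENNReal.ofReal (κ * R) := by
    filter_upwards [aeP] with P hP hPB
    refine line_est q80 (q8.trans hq1) hf hJ he hc (δ := 112000 * q * R) hR hκ P hP ?_ ?_
    · have hPB' : dH HO P < 2 * R := hPB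
      have a1 := abs_le.mp (h1 P (by linarith))
      have d1 := dH_mul P (hh ex ey R)
      have d2 := hh_dH he R
      rw [abs_of_pos hR] at d2
      have a2 := abs_le.mp (h1 (Hmul P (hh ex ey R)) (by linarith))
      have e : ex * (Hmul P (hh ex ey R)).1 + ey * (Hmul P (hh ex ey R)).2.1 =
          ex * P.1 + ey * P.2.1 + R * (ex^2 + ey^2) := by
        simp only [Hmul, hh]; ring
      rw [e, he] at a2
      linarith [a1.2, a2.1]
    · have b1 := mul_le_mul_of_nonneg_right hκq hR.le
      have b2 := mul_le_mul_of_nonneg_right q8 hR.le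
      have b3 := mul_nonneg hq hR.le
      linarith
  have slice : ∀ s ∈ Set.Icc 0 R, ∫⁻ Q in B, G Q ≤ ∫⁻ P in B2, G (Hmul P (hh ex ey s)) := by
    intro s hs
    rw [← lintegral_indicator Bm, ← (mp_right (hh ex ey s)).lintegral_comp (Gm.indicator Bm),
      ← lintegral_indicator B2m]
    refine lintegral_mono fun P => ?_
    by_cases hP : Hmul P (hh ex ey s) ∈ B
    · have hP2 : P ∈ B2 := by
        have hP' : dH HO (Hmul P (hh ex ey s)) < R := hP
        have d1 := dH_mul (Hmul P (hh ex ey s)) (hh ex ey (-s))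
        rw [hh_add, add_neg_cancel, hh_zero] at d1
        have d2 := hh_dH he (-s)
        rw [abs_neg, abs_of_nonneg hs.1] at d2
        have : dH HO P < 2 * R := by linarith [hs.2]
        exact this
      rw [Set.indicator_of_mem hP, Set.indicator_of_mem hP2]
    · rw [Set.indicator_of_notMem hP]; exact zero_le
  have vI : volume (Set.Icc 0 R) = ENNReal.ofReal R := by rw [Real.volume_Icc, sub_zero]
  have total : ENNReal.ofReal R * ∫⁻ Q in B, G Q ≤ ENNReal.ofReal (κ * R) * volume B2 := by
    calc ENNReal.ofReal R * ∫⁻ Q in B, G Q = ∫⁻ s in Set.Icc 0 R, ∫⁻ Q in B, G Q := by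
          rw [setLIntegral_const, vI, mul_comm]
      _ ≤ ∫⁻ s in Set.Icc 0 R, ∫⁻ P in B2, G (Hmul P (hh ex ey s)) :=
          setLIntegral_mono' measurableSet_Icc slice
      _ = ∫⁻ P in B2, ∫⁻ s in Set.Icc 0 R, G (Hmul P (hh ex ey s)) := by
          rw [lintegral_lintegral_swap]
          exact ((Gm.comp pm).comp measurable_swap).aemeasurable
      _ ≤ ∫⁻ P in B2, ENNReal.ofReal (κ * R) := setLIntegral_mono_ae' B2m inner
      _ = _ := by rw [setLIntegral_const]
  have R0 : ENNReal.ofReal R ≠ 0 := by simpa using hR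
  have t2 : ENNReal.ofReal R * ∫⁻ Q in B, G Q ≤
      ENNReal.ofReal R * (ENNReal.ofReal (16 * κ) * volume B) := by
    refine total.trans ((mul_le_mul_right (ball_vol R) _).trans (le_of_eq ?_))
    rw [ENNReal.ofReal_mul hκ.le, ENNReal.ofReal_mul (by norm_num), ENNReal.ofReal_ofNat]
    ring
  exact (ENNReal.mul_le_mul_iff_right R0 ENNReal.ofReal_ne_top).mp t2

lemma matOp_nonneg (A : Matrix (Fin 2) (Fin 2) ℝ) : 0 ≤ matOpNorm A := by
  apply Real.sSup_nonneg
  rintro r ⟨x, y, -, rfl⟩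
  exact Real.sqrt_nonneg _

lemma matOp_le (A : Matrix (Fin 2) (Fin 2) ℝ) :
    matOpNorm A ≤ nm (A 0 0) (A 1 0) + nm (A 0 1) (A 1 1) := by
  apply Real.sSup_le _ (add_nonneg (nm_nonneg _ _) (nm_nonneg _ _))
  rintro r ⟨x, y, hxy, rfl⟩
  have hx : |x| ≤ 1 := abs_le_one_iff_mul_self_le_one.mpr (by linarith [sq_nonneg y])
  have hy : |y| ≤ 1 := abs_le_one_iff_mul_self_le_one.mpr (by linarith [sq_nonneg x])
  have hs : ∀ a b t : ℝ, |t| ≤ 1 → nm (a * t) (b * t) ≤ nm a b := by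
    intro a b t ht
    apply Real.sqrt_le_sqrt
    have h1 : t^2 ≤ 1 := by rw [← sq_abs]; exact pow_le_one₀ (abs_nonneg _) ht
    have h2 := mul_le_mul_of_nonneg_left h1 (add_nonneg (sq_nonneg a) (sq_nonneg b))
    linarith
  have h1 := nm_add (A 0 0 * x) (A 1 0 * x) (A 0 1 * y) (A 1 1 * y)
  have h2 := hs (A 0 0) (A 1 0) x hx
  have h3 := hs (A 0 1) (A 1 1) y hy
  refine le_trans (le_of_eq rfl) (h1.trans (by linarith))

lemma final_est {q : ℝ} (hq : 0 ≤ q) (hq1 : q ≤ 1/100000) {f : H → H} (hf : IsBiLip (q^8) f)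
    (hO : f HO = HO)
    {Jf : H → Matrix (Fin 2) (Fin 2) ℝ} (hJ : ∀ i j : Fin 2, Measurable fun P : H => Jf P i j)
    (hae : ∀ᵐ P ∂(volume : Measure H), HasPansuJacobianAt f (Jf P) P) {R : ℝ} (hR : 0 < R) :
    ∃ A : Matrix (Fin 2) (Fin 2) ℝ, A.transpose * A = 1 ∧ ∀ κ : ℝ, 0 < κ → 250000 * q ≤ κ^2 →
      (volume {Q : H | dH HO Q < R}).toReal⁻¹ *
        ∫ Q in {Q : H | dH HO Q < R}, matOpNorm (Jf Q - A) ≤ 32 * κ := by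
  obtain ⟨c, d, s, hcd, hs, hst⟩ := step1 hq hq1 hf hO (by linarith : 0 < 4 * R)
  refine ⟨!![c, -(s * d); d, s * c], ?_, fun κ hκ hκq => ?_⟩
  · ext i j
    fin_cases i <;> fin_cases j <;> simp [Matrix.mul_apply, Fin.sum_univ_two]
    · linarith
    · ring
    · ring
    · have : s^2 * (c^2 + d^2) = 1 := by rw [hs, hcd, one_mul]
      linarith
  have E1 := dir_est (ex := 1) (ey := 0) (cx := c) (cy := d) hq (by linarith) hf hJ hae
    (by norm_num) hcd hR hκ hκq (fun P hP => by
      have := (hst P hP).1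
      rwa [one_mul, zero_mul, add_zero])
  have E2 := dir_est (ex := 0) (ey := 1) (cx := -(s * d)) (cy := s * c) hq (by linarith) hf hJ hae
    (by norm_num) (by
      have : s^2 * (c^2 + d^2) = 1 := by rw [hs, hcd, one_mul]
      linarith) hR hκ hκq (fun P hP => by
      have := (hst P hP).2
      rwa [one_mul, zero_mul, zero_add])
  simp only [mul_one, mul_zero, add_zero, zero_add] at E1 E2
  set B := {Q : H | dH HO Q < R} with hB
  rcases eq_or_ne (volume B).toReal 0 with h0 | h0
  · rw [h0, inv_zero, zero_mul]; positivity
  have hpos : 0 < (volume B).toReal := lt_of_le_of_ne ENNReal.toReal_nonneg (Ne.symm h0)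
  have hfin : volume B ≠ ⊤ := fun h => h0 (by rw [h]; rfl)
  have gen : ∀ D : H → ℝ, Measurable D → (∀ Q, 0 ≤ D Q) →
      ∫⁻ Q in B, ENNReal.ofReal (D Q) ≤ ENNReal.ofReal (16 * κ) * volume B →
      IntegrableOn D B volume ∧ ∫ Q in B, D Q ≤ 16 * κ * (volume B).toReal := by
    intro D Dm D0 hD
    have ft : ENNReal.ofReal (16 * κ) * volume B ≠ ⊤ := ENNReal.mul_ne_top ENNReal.ofReal_ne_top hfin
    have I : IntegrableOn D B volume := by
      refine ⟨Dm.aestronglyMeasurable, ?_⟩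
      rw [hasFiniteIntegral_iff_ofReal (Filter.Eventually.of_forall D0)]
      exact lt_of_le_of_lt hD (lt_top_iff_ne_top.mpr ft)
    refine ⟨I, ?_⟩
    rw [integral_eq_lintegral_of_nonneg_ae (Filter.Eventually.of_forall D0) I.1]
    have := ENNReal.toReal_mono ft hD
    rwa [ENNReal.toReal_mul, ENNReal.toReal_ofReal (by positivity)] at this
  obtain ⟨I1, J1⟩ := gen _ (nm_meas ((hJ 0 0).sub_const c) ((hJ 1 0).sub_const d))
    (fun Q => nm_nonneg _ _) E1
  obtain ⟨I2, J2⟩ := gen _ (nm_meas ((hJ 0 1).sub_const (-(s * d))) ((hJ 1 1).sub_const (s * c)))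
    (fun Q => nm_nonneg _ _) E2
  have hle : ∫ Q in B, matOpNorm (Jf Q - !![c, -(s * d); d, s * c]) ≤
      ∫ Q in B, (nm (Jf Q 0 0 - c) (Jf Q 1 0 - d) +
        nm (Jf Q 0 1 - -(s * d)) (Jf Q 1 1 - s * c)) := by
    refine integral_mono_of_nonneg (Filter.Eventually.of_forall fun Q => matOp_nonneg _)
      (I1.add I2) (Filter.Eventually.of_forall fun Q => ?_)
    exact matOp_le _
  rw [integral_add I1 I2] at hle
  rw [inv_mul_le_iff₀ hpos]
  linarith

/-- Theorem E, approximation of derivatives.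
There are `ε₀ > 0` and `C > 0` such that if `f` is `(1+ε)`-biLipschitz with
`0 ≤ ε < ε₀` and `f(O) = O`, then for every `R > 0` there exists `A ∈ O(2)` with
`(1/ℒ(B(O,R))) ∫_{B(O,R)} ‖Jf(Q) − A‖ dQ ≤ C ε^{1/4096}`, where `Jf` is the
a.e.-defined Pansu Jacobian matrix of `f`. -/
theorem statement6 :
    ∃ ε₀ > (0:ℝ), ∃ C > (0:ℝ),
      ∀ ε : ℝ, 0 ≤ ε → ε < ε₀ →
      ∀ f : H → H, IsBiLip ε f → f HO = HO →
      ∀ Jf : H → Matrix (Fin 2) (Fin 2) ℝ,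
        (∀ i j : Fin 2, Measurable fun P : H => Jf P i j) →
        (∀ᵐ P ∂volume, HasPansuJacobianAt f (Jf P) P) →
      ∀ R : ℝ, 0 < R →
        ∃ A : Matrix (Fin 2) (Fin 2) ℝ, A.transpose * A = 1 ∧
          (volume {Q : H | dH HO Q < R}).toReal⁻¹ *
              ∫ Q in {Q : H | dH HO Q < R}, matOpNorm (Jf Q - A)
            ≤ C * ε ^ ((1:ℝ)/4096) := by
  refine ⟨(1/100000)^8, by norm_num, 16000, by norm_num, ?_⟩
  intro ε hε0 hε f hf hO Jf hJ hae R hR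
  set q : ℝ := ε ^ ((1:ℝ)/8) with hq
  have q0 : 0 ≤ q := Real.rpow_nonneg hε0 _
  have q8 : q^8 = ε := by
    rw [hq, ← Real.rpow_natCast, ← Real.rpow_mul hε0]
    norm_num
  have q1 : q ≤ 1/100000 := by
    refine le_of_lt (lt_of_pow_lt_pow_left₀ 8 (by norm_num) ?_)
    rw [q8]; exact hε
  obtain ⟨A, hA, hk⟩ := final_est q0 q1 (by rw [q8]; exact hf) hO hJ hae hR
  refine ⟨A, hA, ?_⟩
  rcases hε0.eq_or_lt with h | h
  · have q00 : q = 0 := by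
      have : q^8 = 0 := by rw [q8, h]
      exact pow_eq_zero_iff (by norm_num) |>.mp this
    rw [← h, Real.zero_rpow (by norm_num), mul_zero]
    refine le_of_forall_pos_le_add fun δ hδ => ?_
    have := hk (δ / 32) (by positivity) (by rw [q00, mul_zero]; positivity)
    linarith
  · have hk' := hk (500 * ε ^ ((1:ℝ)/16)) (by positivity) (by
      have : (ε ^ ((1:ℝ)/16))^2 = q := by
        rw [hq, ← Real.rpow_natCast, ← Real.rpow_mul hε0]
        norm_num
      rw [mul_pow, this]; linarith)
    have hε1 : ε ≤ 1 := by
      refine hε.le.trans ?_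
      norm_num
    have := Real.rpow_le_rpow_of_exponent_ge h hε1 (by norm_num : (1:ℝ)/4096 ≤ 1/16)
    linarith
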